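/- arXiv:1803.05361 — 13 statements merged into one kernel-verified Lean document; each statement's English description precedes it below -/
import Mathlib

section
/- Fix an integer q ≥ 1 and reals α_1,…,α_q > 1, and set α_max = max_j α_j. Let E be a finite set; for each e ∈ E let σ_e ≥ 0 and ξ_{e,j} > 0 for j = 1,…,q. Let N ≥ 1 be an integer and, for each player i ∈ {1,…,N}, let w_i : E → ℝ satisfy w_i(e) ≥ 1 for all e. For a strategy profile p = (p_1,…,p_N) of finite subsets of E, let l_e^p = Σ_{i : e ∈ p_i} w_i(e) and C(p) = Σ_{e ∈ E, l_e^p > 0} (σ_e + Σ_{j=1}^q ξ_{e,j}·(l_e^p)^{α_j}). For each j fix an integer K_j ≥ 1 and, for k = 1,…,K_j, reals z_{k,j} ≥ 0, x_{k,j} ∈ [0, α_j − 1], y_{k,j} ∈ [1, α_j] with x_{k,j} + y_{k,j} = α_j; let z ≥ 1 be a real with z ≥ z_{k,j} for all k, j, and set λ_α = max_j (2·K_j·z)^{α_max + 1}. Let γ be a real such that γ ≥ min_{j ∈ {1,…,q}} ((1/(α_j − 1))·σ_e/ξ_{e,j})^{1/α_j} for every e ∈ E, and let ϱ ≥ 1.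 Let p and p' be two strategy profiles and suppose that for each i and each e ∈ E a real g_{i,e} ≥ 0 is given such that g_{i,e} = 0 whenever e ∉ p'_i, and g_{i,e} ≤ σ_e + Σ_{j=1}^q ξ_{e,j} Σ_{k=1}^{K_j} z_{k,j}·(l_e^{(p'_i, p_{−i})} − w_i(e))^{x_{k,j}}·(w_i(e))^{y_{k,j}} whenever e ∈ p'_i, where (p'_i, p_{−i}) denotes the profile obtained from p by replacing p_i with p'_i. Then Σ_{i=1}^N Σ_{e ∈ E} g_{i,e} ≤ (γ + λ_α·ϱ^{α_max})·C(p') + C(p)/(2ϱ). -/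
/-- The load `l_e^p = Σ_{i : e ∈ p_i} w_i(e)` induced on resource `e` by the
strategy profile `p`. -/
noncomputable def load {E : Type*} [Fintype E] [DecidableEq E] {N : ℕ}
    (w : Fin N → E → ℝ) (p : Fin N → Finset E) (e : E) : ℝ :=
  ∑ i : Fin N, if e ∈ p i then w i e else 0

/-- The total cost `C(p) = Σ_{e : l_e^p > 0} (σ_e + Σ_j ξ_{e,j}·(l_e^p)^{α_j})`
of a strategy profile under REP resource cost functions (real powers). -/
noncomputable def totalCost {E : Type*} [Fintype E] [DecidableEq E] {N q : ℕ}
    (α : Fin q → ℝ) (σ : E → ℝ) (ξ : E → Fin q → ℝ)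
    (w : Fin N → E → ℝ) (p : Fin N → Finset E) : ℝ :=
  ∑ e : E, if 0 < load w p e then σ e + ∑ j, ξ e j * load w p e ^ α j else 0

/-- Removing the deviating player's own weight leaves at most the original load. -/
lemma load_update_sub_mem_Icc {E : Type*} [Fintype E] [DecidableEq E] {N : ℕ}
    {w : Fin N → E → ℝ} (hw : ∀ i e, 0 ≤ w i e) (p : Fin N → Finset E)
    {i : Fin N} {s : Finset E} {e : E} (he : e ∈ s) :
    load w (Function.update p i s) e - w i e ∈ Set.Icc 0 (load w p e) := by
  have hnonneg (k : Fin N) : 0 ≤ if e ∈ p k then w k e else 0 := by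
    split_ifs
    exacts [hw k e, le_rfl]
  have hsum : load w (Function.update p i s) e =
      w i e + ∑ k ∈ Finset.univ.erase i, if e ∈ p k then w k e else 0 := by
    rw [load, ← Finset.add_sum_erase _ _ (Finset.mem_univ i)]
    congr 1
    · simp [he]
    · refine Finset.sum_congr rfl fun k hk => ?_
      rw [Function.update_of_ne (Finset.ne_of_mem_erase hk)]
  rw [hsum, add_sub_cancel_left]
  refine ⟨Finset.sum_nonneg fun k _ => hnonneg k, ?_⟩
  exact Finset.sum_le_sum_of_subset_of_nonneg (Finset.erase_subset _ _) fun k _ _ => hnonneg k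

/-- With `γ = (σ / ((a - 1) ξ)) ^ (1 / a)`, the startup cost scaled by the load `l` is at most
`γ` times the full cost of that load. -/
lemma mul_le_rpow_inv_mul_cost {a σ ξ l : ℝ} (ha : 1 < a) (hσ : 0 ≤ σ) (hξ : 0 < ξ)
    (hl : 0 ≤ l) :
    l * σ ≤ (1 / (a - 1) * (σ / ξ)) ^ (1 / a) * (σ + ξ * l ^ a) := by
  have ha' : 0 < a - 1 := by linarith
  set c := (1 / (a - 1) * (σ / ξ)) ^ (1 / a) with hc
  have hbase : 0 ≤ 1 / (a - 1) * (σ / ξ) := by positivity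
  rcases hσ.eq_or_lt with rfl | hσ
  · rw [mul_zero]; positivity
  have hc0 : 0 < c := by positivity
  have hca : σ = ξ * (a - 1) * c ^ a := by
    rw [hc, ← Real.rpow_mul hbase, one_div_mul_cancel (by linarith), Real.rpow_one]
    field_simp
  have hbern : 1 + a * (l / c - 1) ≤ (l / c) ^ a := by
    have h := one_add_mul_self_le_rpow_one_add
      (by have : 0 ≤ l / c := by positivity
          linarith : -1 ≤ l / c - 1) ha.le
    rwa [add_sub_cancel] at h
  have ht : 0 ≤ l / c := by positivity
  have hkey : (a - 1) * (l / c) ≤ (a - 1) + (l / c) ^ a := by linarith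
  calc l * σ = ξ * c ^ a * c * ((a - 1) * (l / c)) := by
        rw [hca]; field_simp
    _ ≤ ξ * c ^ a * c * ((a - 1) + (l / c) ^ a) := by gcongr
    _ = c * (σ + ξ * l ^ a) := by
        rw [hca, Real.div_rpow hl hc0.le]; field_simp

/-- Splitting a product of powers according to whether `a` exceeds `M * b`. -/
lemma rpow_mul_rpow_le_add {a b M s t : ℝ} (ha : 0 ≤ a) (hb : 0 < b) (hM : 1 ≤ M)
    (hs : 0 ≤ s) (ht : 1 ≤ t) :
    a ^ s * b ^ t ≤ a ^ (s + t) / M + M ^ s * b ^ (s + t) := by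
  have hM0 : 0 < M := by linarith
  rcases le_total (M * b) a with h | h
  · have ha0 : 0 < a := (mul_pos hM0 hb).trans_le h
    have hpow : M * b ^ t ≤ a ^ t :=
      calc M * b ^ t ≤ M ^ t * b ^ t := by
            gcongr
            exact Real.self_le_rpow_of_one_le hM ht
        _ = (M * b) ^ t := (Real.mul_rpow hM0.le hb.le).symm
        _ ≤ a ^ t := by gcongr
    have : a ^ s * b ^ t ≤ a ^ (s + t) / M := by
      rw [le_div_iff₀ hM0, Real.rpow_add ha0]
      calc a ^ s * b ^ t * M = a ^ s * (M * b ^ t) := by ring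
        _ ≤ _ := by gcongr
    have : 0 ≤ M ^ s * b ^ (s + t) := by positivity
    linarith
  · have : a ^ s * b ^ t ≤ M ^ s * b ^ (s + t) :=
      calc a ^ s * b ^ t ≤ (M * b) ^ s * b ^ t := by gcongr
        _ = M ^ s * b ^ (s + t) := by
            rw [Real.mul_rpow hM0.le hb.le, Real.rpow_add hb, mul_assoc]
    have : 0 ≤ a ^ (s + t) / M := by positivity
    linarith

/-- The expanded power terms of one exponent are bounded by the powers of the two loads. -/
lemma sum_mul_rpow_mul_rpow_le {a b A α z rho : ℝ} {K : ℕ} {c x y : Fin K → ℝ}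
    (ha : 0 ≤ a) (hb : 0 < b) (hK : 1 ≤ K) (hA : α ≤ A) (hz : 1 ≤ z)
    (hrho : 1 ≤ rho) (hc : ∀ k, c k ≤ z)
    (hx : ∀ k, x k ∈ Set.Icc 0 (α - 1)) (hy : ∀ k, 1 ≤ y k) (hxy : ∀ k, x k + y k = α) :
    ∑ k, c k * a ^ x k * b ^ y k ≤
      (2 * (K : ℝ) * z) ^ (A + 1) * rho ^ A * b ^ α + a ^ α / (2 * rho) := by
  have hK' : (1 : ℝ) ≤ K := by exact_mod_cast hK
  have hKz : 1 ≤ 2 * (K : ℝ) * z := by nlinarith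
  have hM : 1 ≤ 2 * (K : ℝ) * z * rho := by nlinarith
  set M := 2 * (K : ℝ) * z * rho with hMdef
  have hterm (k : Fin K) : c k * a ^ x k * b ^ y k ≤ z * (a ^ α / M + M ^ A * b ^ α) :=
    calc c k * a ^ x k * b ^ y k = c k * (a ^ x k * b ^ y k) := mul_assoc _ _ _
      _ ≤ z * (a ^ x k * b ^ y k) := by gcongr; exact hc k
      _ ≤ z * (a ^ α / M + M ^ x k * b ^ α) := by
          have h := rpow_mul_rpow_le_add ha hb hM (hx k).1 (hy k)
          rw [hxy k] at h
          gcongr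
      _ ≤ _ := by
          gcongr
          linarith [(hx k).2]
  calc ∑ k, c k * a ^ x k * b ^ y k ≤ ∑ _k : Fin K, z * (a ^ α / M + M ^ A * b ^ α) :=
        Finset.sum_le_sum fun k _ => hterm k
    _ = K * z * (M ^ A * b ^ α) + a ^ α / (2 * rho) := by
        rw [Finset.sum_const, Finset.card_univ, Fintype.card_fin, nsmul_eq_mul, hMdef]
        field_simp
        ring
    _ ≤ 2 * K * z * (M ^ A * b ^ α) + a ^ α / (2 * rho) := by
        gcongr
        linarith
    _ = _ := by
        rw [hMdef, Real.mul_rpow (by positivity) (by positivity),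
          Real.rpow_add_one (by positivity)]
        ring

/-- Theorem 7.1: smoothness of GND games with REP cost functions under
an REP-expanded cost sharing mechanism.  Here `g i e` plays the role of the cost
share of player `i` on resource `e` in the deviated profile `(p'_i, p_{−i})`, and the
conclusion is the (λ,μ)-smoothness inequality with `λ = γ + λ_α·ϱ^{α_max}` and
`μ = 1/(2ϱ)`. -/
theorem rep_expanded_smoothness
    {q : ℕ} (hq : 1 ≤ q) (α : Fin q → ℝ) (hα : ∀ j, 1 < α j)
    (αmax : ℝ) (hmax₁ : ∀ j, α j ≤ αmax) (hmax₂ : ∃ j, αmax = α j)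
    {E : Type*} [Fintype E] [DecidableEq E]
    (σ : E → ℝ) (hσ : ∀ e, 0 ≤ σ e)
    (ξ : E → Fin q → ℝ) (hξ : ∀ e j, 0 < ξ e j)
    {N : ℕ} (hN : 1 ≤ N)
    (w : Fin N → E → ℝ) (hw : ∀ i e, 1 ≤ w i e)
    (K : Fin q → ℕ) (hK : ∀ j, 1 ≤ K j)
    (zc : (j : Fin q) → Fin (K j) → ℝ) (hzc : ∀ j k, 0 ≤ zc j k)
    (x y : (j : Fin q) → Fin (K j) → ℝ)
    (hx : ∀ j k, x j k ∈ Set.Icc 0 (α j - 1))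
    (hy : ∀ j k, y j k ∈ Set.Icc 1 (α j))
    (hxy : ∀ j k, x j k + y j k = α j)
    (z : ℝ) (hz : 1 ≤ z) (hzz : ∀ j k, zc j k ≤ z)
    (lamα : ℝ)
    (hlam₁ : ∀ j, (2 * (K j : ℝ) * z) ^ (αmax + 1) ≤ lamα)
    (hlam₂ : ∃ j, lamα = (2 * (K j : ℝ) * z) ^ (αmax + 1))
    (γ : ℝ)
    (hγ : ∀ e, ∃ j, (1 / (α j - 1) * (σ e / ξ e j)) ^ (1 / α j) ≤ γ)
    (rho : ℝ) (hrho : 1 ≤ rho)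
    (p p' : Fin N → Finset E)
    (g : Fin N → E → ℝ)
    (hg0 : ∀ i e, 0 ≤ g i e)
    (hg1 : ∀ i e, e ∉ p' i → g i e = 0)
    (hg2 : ∀ i e, e ∈ p' i →
      g i e ≤ σ e + ∑ j, ξ e j * ∑ k, zc j k *
        (load w (Function.update p i (p' i)) e - w i e) ^ x j k * w i e ^ y j k) :
    ∑ i, ∑ e, g i e ≤
      (γ + lamα * rho ^ αmax) * totalCost α σ ξ w p' +
        totalCost α σ ξ w p / (2 * rho) := by
  have hw0 (i e) : 0 ≤ w i e := zero_le_one.trans (hw i e)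
  have hload0 (r : Fin N → Finset E) (e : E) : 0 ≤ load w r e :=
    Finset.sum_nonneg fun i _ => by
      split_ifs
      exacts [hw0 i e, le_rfl]
  rw [Finset.sum_comm, totalCost, totalCost, Finset.mul_sum, Finset.sum_div,
    ← Finset.sum_add_distrib]
  refine Finset.sum_le_sum fun e _ => ?_
  obtain ⟨j₀, hj₀⟩ := hγ e
  have hrho0 : 0 < rho := by linarith
  have hγ0 : 0 ≤ γ := by
    have h1 : 0 ≤ 1 / (α j₀ - 1) * (σ e / ξ e j₀) :=
      mul_nonneg (one_div_nonneg.2 (by linarith [hα j₀])) (div_nonneg (hσ e) (hξ e j₀).le)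
    exact (Real.rpow_nonneg h1 _).trans hj₀
  have hlam0 : 0 ≤ lamα := by
    refine le_trans ?_ (hlam₁ j₀)
    positivity
  set a := load w p e with ha
  set b := load w p' e with hb
  have ha0 : 0 ≤ a := hload0 p e
  have hpow0 : 0 ≤ ∑ j, ξ e j * a ^ α j :=
    Finset.sum_nonneg fun j _ => mul_nonneg (hξ e j).le (Real.rpow_nonneg ha0 _)
  have hcost : ∑ j, ξ e j * a ^ α j ≤ if 0 < a then σ e + ∑ j, ξ e j * a ^ α j else 0 := by
    split_ifs with h
    · linarith [hσ e]
    · have ha_zero : a = 0 := le_antisymm (not_lt.1 h) ha0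
      refine (Finset.sum_eq_zero fun j _ => ?_).le
      rw [ha_zero, Real.zero_rpow (by linarith [hα j]), mul_zero]
  have hcost0 := hpow0.trans hcost
  have hwb (i : Fin N) (hi : e ∈ p' i) : w i e ≤ b := by
    have hle : (if e ∈ p' i then w i e else 0) ≤ b :=
      Finset.single_le_sum (f := fun i => if e ∈ p' i then w i e else 0)
        (fun k _ => by split_ifs; exacts [hw0 k e, le_rfl]) (Finset.mem_univ i)
    rwa [if_pos hi] at hle
  by_cases hbpos : 0 < b
  swap
  · rw [if_neg hbpos, mul_zero, zero_add]
    refine le_trans (Finset.sum_nonpos fun i _ => ?_) (div_nonneg hcost0 (by positivity))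
    by_cases hi : e ∈ p' i
    · linarith [hw i e, hwb i hi]
    · exact (hg1 i e hi).le
  rw [if_pos hbpos]
  set S := ∑ j, ξ e j * ∑ k, zc j k * a ^ x j k * b ^ y j k with hS
  have hshare (i : Fin N) : g i e ≤ (if e ∈ p' i then w i e else 0) * (σ e + S / b) := by
    split_ifs with hi
    swap
    · rw [hg1 i e hi, zero_mul]
    have hwpos : 0 < w i e := zero_lt_one.trans_le (hw i e)
    obtain ⟨hd0, hda⟩ := load_update_sub_mem_Icc hw0 p (i := i) hi
    refine (hg2 i e hi).trans ?_
    rw [mul_add]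
    refine add_le_add (le_mul_of_one_le_left (hσ e) (hw i e)) ?_
    rw [hS, Finset.sum_div, Finset.mul_sum]
    refine Finset.sum_le_sum fun j _ => ?_
    rw [mul_div_assoc, mul_left_comm]
    refine mul_le_mul_of_nonneg_left ?_ (hξ e j).le
    rw [Finset.sum_div, Finset.mul_sum]
    refine Finset.sum_le_sum fun k _ => ?_
    have hpow : w i e ^ y j k ≤ w i e * (b ^ y j k / b) := by
      rw [← Real.rpow_sub_one hbpos.ne']
      calc w i e ^ y j k = w i e * w i e ^ (y j k - 1) := by
            rw [Real.rpow_sub_one hwpos.ne', mul_div_cancel₀ _ hwpos.ne']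
        _ ≤ _ := by
            gcongr
            exacts [by linarith [(hy j k).1], hwb i hi]
    calc _ ≤ zc j k * a ^ x j k * (w i e * (b ^ y j k / b)) := by
          have := hzc j k
          have := (hx j k).1
          gcongr
      _ = _ := by ring
  have hstart : b * σ e ≤ γ * (σ e + ∑ j, ξ e j * b ^ α j) :=
    calc b * σ e ≤ _ := mul_le_rpow_inv_mul_cost (hα j₀) (hσ e) (hξ e j₀) hbpos.le
      _ ≤ γ * (σ e + ξ e j₀ * b ^ α j₀) := by
          have := hσ e
          have := hξ e j₀
          gcongr
      _ ≤ _ := by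
          gcongr
          exact Finset.single_le_sum (f := fun j => ξ e j * b ^ α j)
            (fun j _ => mul_nonneg (hξ e j).le (Real.rpow_nonneg hbpos.le _))
            (Finset.mem_univ j₀)
  have hexp : S ≤ lamα * rho ^ αmax * ∑ j, ξ e j * b ^ α j +
      (∑ j, ξ e j * a ^ α j) / (2 * rho) := by
    rw [hS, Finset.mul_sum, Finset.sum_div, ← Finset.sum_add_distrib]
    refine Finset.sum_le_sum fun j _ => ?_
    rw [mul_left_comm, mul_div_assoc, ← mul_add]
    refine mul_le_mul_of_nonneg_left ?_ (hξ e j).le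
    refine (sum_mul_rpow_mul_rpow_le ha0 hbpos (hK j) (hmax₁ j) hz hrho (hzz j) (hx j)
      (fun k => (hy j k).1) (hxy j)).trans ?_
    gcongr
    exact hlam₁ j
  calc ∑ i, g i e ≤ ∑ i, (if e ∈ p' i then w i e else 0) * (σ e + S / b) :=
        Finset.sum_le_sum fun i _ => hshare i
    _ = b * σ e + S := by
        rw [← Finset.sum_mul, ← load, ← hb, mul_add, mul_div_cancel₀ _ hbpos.ne']
    _ ≤ γ * (σ e + ∑ j, ξ e j * b ^ α j) + (lamα * rho ^ αmax * ∑ j, ξ e j * b ^ α j +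
          (∑ j, ξ e j * a ^ α j) / (2 * rho)) := add_le_add hstart hexp
    _ ≤ γ * (σ e + ∑ j, ξ e j * b ^ α j) +
          (lamα * rho ^ αmax * (σ e + ∑ j, ξ e j * b ^ α j) +
          (if 0 < a then σ e + ∑ j, ξ e j * a ^ α j else 0) / (2 * rho)) := by
        gcongr
        linarith [hσ e]
    _ = _ := by ring
end

section
/- Fix an integer q ≥ 1, reals α_1,…,α_q > 1, and an integer N ≥ 1. Let E be a finite set; for each e ∈ E let σ_e ≥ 0 and ξ_{e,j} ≥ 0 for j = 1,…,q. For each player i ∈ {1,…,N} let w_i : E → ℝ satisfy w_i(e) ≥ 1 for all e. For a strategy profile p = (p_1,…,p_N) of finite subsets of E, let S_e = {i : e ∈ p_i}, l_e^p = Σ_{i ∈ S_e} w_i(e), C(p) = Σ_{e : S_e ≠ ∅} (σ_e + Σ_j ξ_{e,j}·(l_e^p)^{α_j}), h_e(T) = Σ_{j=1}^q ξ_{e,j}·(Σ_{i ∈ T} w_i(e))^{α_j} for T ⊆ {1,…,N}, and define the potential Φ(p) = Σ_{e : S_e ≠ ∅} Σ_{k=1}^{|S_e|} ( σ_e/k +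 Σ_{T ⊆ S_e, |T| = k} h_e(T) / (binom(|S_e|, k)·k) ). Then (1/⌈max_j α_j⌉)·C(p) ≤ Φ(p) ≤ H_N·C(p), where H_N = Σ_{k=1}^N 1/k is the N-th harmonic number and ⌈·⌉ is the ceiling. -/
/-- The set `S_e = {i : e ∈ p_i}` of players using resource `e` under profile `p`. -/
def users {E : Type*} [DecidableEq E] {N : ℕ}
    (p : Fin N → Finset E) (e : E) : Finset (Fin N) :=
  Finset.univ.filter fun i => e ∈ p i

/-- The social cost `C(p) = Σ_{e : S_e ≠ ∅} (σ_e + Σ_j ξ_{e,j}·(l_e^p)^{α_j})`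
(real powers). -/
noncomputable def socialCost {E : Type*} [Fintype E] [DecidableEq E] {N q : ℕ}
    (α : Fin q → ℝ) (σ : E → ℝ) (ξ : E → Fin q → ℝ)
    (w : Fin N → E → ℝ) (p : Fin N → Finset E) : ℝ :=
  ∑ e : E, if (users p e).Nonempty then
      σ e + ∑ j, ξ e j * (∑ i ∈ users p e, w i e) ^ α j
    else 0

/-- The potential function of the Shapley cost sharing mechanism, in the closed form
`Φ(p) = Σ_{e : S_e ≠ ∅} Σ_{k=1}^{|S_e|} (σ_e/k + Σ_{T ⊆ S_e, |T| = k}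
        h_e(T)/(binom(|S_e|,k)·k))`
where `h_e(T) = Σ_j ξ_{e,j}·(Σ_{i ∈ T} w_i(e))^{α_j}`. -/
noncomputable def shapleyPotential {E : Type*} [Fintype E] [DecidableEq E] {N q : ℕ}
    (α : Fin q → ℝ) (σ : E → ℝ) (ξ : E → Fin q → ℝ)
    (w : Fin N → E → ℝ) (p : Fin N → Finset E) : ℝ :=
  ∑ e : E, if (users p e).Nonempty then
      ∑ k ∈ Finset.Icc 1 (users p e).card,
        (σ e / (k : ℝ) +
          ∑ T ∈ (users p e).powersetCard k,
            (∑ j, ξ e j * (∑ i ∈ T, w i e) ^ α j) /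
              (((users p e).card.choose k : ℝ) * (k : ℝ)))
    else 0

/-- Each element of `s` lies in the same number of `k`-subsets of `s`. -/
theorem card_mul_sum_powersetCard_sum {ι : Type*} [DecidableEq ι] (s : Finset ι) (f : ι → ℝ)
    {k : ℕ} (hk : 1 ≤ k) :
    (s.card : ℝ) * ∑ t ∈ s.powersetCard k, ∑ i ∈ t, f i =
      (s.card.choose k : ℝ) * k * ∑ i ∈ s, f i := by
  have hcomm : ∑ t ∈ s.powersetCard k, ∑ i ∈ t, f i =
      ∑ i ∈ s, ∑ t ∈ (s.powersetCard k).filter ({i} ⊆ ·), f i := by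
    apply Finset.sum_comm'
    intro t i
    simp only [Finset.mem_powersetCard, Finset.mem_filter, Finset.singleton_subset_iff]
    exact ⟨fun h => ⟨⟨h.1, h.2⟩, h.1.1 h.2⟩, fun h => h.1⟩
  rw [hcomm, Finset.mul_sum, Finset.mul_sum]
  refine Finset.sum_congr rfl fun i hi => ?_
  rw [Finset.sum_const, Finset.card_filter_powersetCard_subset _ _ _
    (Finset.singleton_subset_iff.2 hi) (by simpa using hk), nsmul_eq_mul, ← mul_assoc]
  congr 1
  obtain ⟨m, hm⟩ : ∃ m, s.card = m + 1 :=
    ⟨s.card - 1, (Nat.sub_add_cancel (Finset.card_pos.2 ⟨i, hi⟩)).symm⟩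
  obtain ⟨l, rfl⟩ : ∃ l, k = l + 1 := ⟨k - 1, (Nat.sub_add_cancel hk).symm⟩
  rw [hm, Finset.card_singleton, Nat.add_sub_cancel, Nat.add_sub_cancel]
  exact_mod_cast Nat.add_one_mul_choose_eq m l

/-- Jensen's inequality for the average of `(∑ i ∈ t, f i) ^ a` over the `k`-subsets `t` of `s`. -/
theorem rpow_le_average_powersetCard_rpow {ι : Type*} [DecidableEq ι] (s : Finset ι) (f : ι → ℝ)
    (hf : ∀ i ∈ s, 0 ≤ f i) {a : ℝ} (ha : 1 ≤ a) {k : ℕ} (hk : 1 ≤ k) (hks : k ≤ s.card) :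
    ((k : ℝ) / s.card * ∑ i ∈ s, f i) ^ a ≤
      (∑ t ∈ s.powersetCard k, (∑ i ∈ t, f i) ^ a) / (s.card.choose k : ℝ) := by
  have hc : (0 : ℝ) < s.card.choose k := by exact_mod_cast Nat.choose_pos hks
  have hs : (0 : ℝ) < s.card := by exact_mod_cast hk.trans hks
  have hJ := Real.rpow_arith_mean_le_arith_mean_rpow (s.powersetCard k)
    (fun _ => ((s.card.choose k : ℝ))⁻¹) (fun t => ∑ i ∈ t, f i)
    (fun _ _ => by positivity)
    (by rw [Finset.sum_const, Finset.card_powersetCard, nsmul_eq_mul, mul_inv_cancel₀ hc.ne'])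
    (fun t ht => Finset.sum_nonneg fun i hi => hf i ((Finset.mem_powersetCard.1 ht).1 hi)) ha
  rw [← Finset.mul_sum, ← Finset.mul_sum] at hJ
  have havg : (k : ℝ) / s.card * ∑ i ∈ s, f i =
      ((s.card.choose k : ℝ))⁻¹ * ∑ t ∈ s.powersetCard k, ∑ i ∈ t, f i := by
    have := card_mul_sum_powersetCard_sum s f hk
    field_simp
    linarith
  rw [havg, div_eq_inv_mul]
  exact hJ

theorem average_powersetCard_rpow_le {ι : Type*} (s : Finset ι) (f : ι → ℝ)
    (hf : ∀ i ∈ s, 0 ≤ f i) {a : ℝ} (ha : 0 ≤ a) {k : ℕ} (hks : k ≤ s.card) :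
    (∑ t ∈ s.powersetCard k, (∑ i ∈ t, f i) ^ a) / (s.card.choose k : ℝ) ≤
      (∑ i ∈ s, f i) ^ a := by
  have hc : (0 : ℝ) < s.card.choose k := by exact_mod_cast Nat.choose_pos hks
  rw [div_le_iff₀' hc, ← nsmul_eq_mul, ← Finset.card_powersetCard]
  refine Finset.sum_le_card_nsmul _ _ _ fun t ht => ?_
  have hts := (Finset.mem_powersetCard.1 ht).1
  exact Real.rpow_le_rpow (Finset.sum_nonneg fun i hi => hf i (hts hi))
    (Finset.sum_le_sum_of_subset_of_nonneg hts fun i hi _ => hf i hi) ha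

/-- Discrete form of `n ^ a / a = ∫ x in 0..n, x ^ (a - 1)`. -/
theorem rpow_le_mul_sum_rpow_sub_one {a : ℝ} (ha : 1 ≤ a) (n : ℕ) :
    (n : ℝ) ^ a ≤ a * ∑ k ∈ Finset.Icc 1 n, (k : ℝ) ^ (a - 1) := by
  induction n with
  | zero => simp [Real.zero_rpow (by linarith : a ≠ 0)]
  | succ n ih =>
    rw [Finset.sum_Icc_succ_top (by omega), mul_add]
    have hn : (0 : ℝ) < n + 1 := by positivity
    have hB := one_add_mul_self_le_rpow_one_add (s := -(1 / ((n : ℝ) + 1)))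
      (by rw [neg_le_neg_iff, div_le_one hn]; linarith [n.cast_nonneg (α := ℝ)]) ha
    have hbase : 1 + -(1 / ((n : ℝ) + 1)) = n / (n + 1) := by field_simp; ring
    have hpow : ((n : ℝ) + 1) ^ a = (n + 1) ^ (a - 1) * (n + 1) := by
      rw [← Real.rpow_add_one hn.ne', sub_add_cancel]
    rw [hbase, Real.div_rpow n.cast_nonneg hn.le, le_div_iff₀ (by positivity), hpow] at hB
    have hexp : (1 + a * -(1 / ((n : ℝ) + 1))) * ((n + 1) ^ (a - 1) * (n + 1)) =
        (n + 1) ^ (a - 1) * (n + 1) - a * (n + 1) ^ (a - 1) := by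
      field_simp
      ring
    push_cast
    rw [hpow]
    linarith

theorem rpow_le_mul_sum_average_powersetCard_rpow {ι : Type*} [DecidableEq ι] (s : Finset ι)
    (f : ι → ℝ) (hf : ∀ i ∈ s, 0 ≤ f i) {a : ℝ} (ha : 1 ≤ a) (hs : s.Nonempty) :
    (∑ i ∈ s, f i) ^ a ≤ a * ∑ k ∈ Finset.Icc 1 s.card,
      (∑ t ∈ s.powersetCard k, (∑ i ∈ t, f i) ^ a) / (s.card.choose k : ℝ) / k := by
  have hn : (0 : ℝ) < s.card := by exact_mod_cast hs.card_pos
  have hL : 0 ≤ ∑ i ∈ s, f i := Finset.sum_nonneg hf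
  have hterm : ∀ k ∈ Finset.Icc 1 s.card,
      ((∑ i ∈ s, f i) / s.card) ^ a * (k : ℝ) ^ (a - 1) ≤
      (∑ t ∈ s.powersetCard k, (∑ i ∈ t, f i) ^ a) / (s.card.choose k : ℝ) / k := by
    intro k hk
    obtain ⟨hk1, hkn⟩ := Finset.mem_Icc.1 hk
    have hk0 : (0 : ℝ) < k := by exact_mod_cast hk1
    rw [le_div_iff₀ hk0, mul_assoc, ← Real.rpow_add_one hk0.ne', sub_add_cancel,
      ← Real.mul_rpow (by positivity) hk0.le, div_mul_comm]
    exact rpow_le_average_powersetCard_rpow s f hf ha hk1 hkn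
  calc (∑ i ∈ s, f i) ^ a = ((∑ i ∈ s, f i) / s.card) ^ a * (s.card : ℝ) ^ a := by
        rw [← Real.mul_rpow (by positivity) hn.le, div_mul_cancel₀ _ hn.ne']
    _ ≤ ((∑ i ∈ s, f i) / s.card) ^ a *
          (a * ∑ k ∈ Finset.Icc 1 s.card, (k : ℝ) ^ (a - 1)) := by
        gcongr
        exact rpow_le_mul_sum_rpow_sub_one ha _
    _ = a * ∑ k ∈ Finset.Icc 1 s.card,
          ((∑ i ∈ s, f i) / s.card) ^ a * (k : ℝ) ^ (a - 1) := by
        rw [← Finset.mul_sum]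
        ring
    _ ≤ _ := by
        gcongr with k hk
        exact hterm k hk

theorem sum_average_powersetCard_rpow_le {ι : Type*} (s : Finset ι) (f : ι → ℝ)
    (hf : ∀ i ∈ s, 0 ≤ f i) {a : ℝ} (ha : 0 ≤ a) :
    ∑ k ∈ Finset.Icc 1 s.card,
      (∑ t ∈ s.powersetCard k, (∑ i ∈ t, f i) ^ a) / (s.card.choose k : ℝ) / k ≤
      (∑ k ∈ Finset.Icc 1 s.card, (1 : ℝ) / k) * (∑ i ∈ s, f i) ^ a := by
  rw [Finset.sum_mul]
  refine Finset.sum_le_sum fun k hk => ?_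
  rw [one_div_mul_eq_div]
  gcongr
  exact average_powersetCard_rpow_le s f hf ha (Finset.mem_Icc.1 hk).2

/-- Separates the fixed cost and the individual monomials in the contribution of one resource. -/
theorem sum_fixed_add_average_powersetCard {ι κ : Type*} [Fintype κ] (s : Finset ι) (f : ι → ℝ)
    (c : ℝ) (x a : κ → ℝ) :
    ∑ k ∈ Finset.Icc 1 s.card, (c / (k : ℝ) +
      ∑ t ∈ s.powersetCard k, (∑ j, x j * (∑ i ∈ t, f i) ^ a j) /
        ((s.card.choose k : ℝ) * (k : ℝ))) =
    (∑ k ∈ Finset.Icc 1 s.card, (1 : ℝ) / k) * c +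
      ∑ j, x j * ∑ k ∈ Finset.Icc 1 s.card,
        (∑ t ∈ s.powersetCard k, (∑ i ∈ t, f i) ^ a j) / (s.card.choose k : ℝ) / k := by
  rw [Finset.sum_add_distrib, Finset.sum_mul]
  congr 1
  · exact Finset.sum_congr rfl fun k _ => (one_div_mul_eq_div _ _).symm
  · simp_rw [Finset.mul_sum]
    rw [Finset.sum_comm]
    refine Finset.sum_congr rfl fun k _ => ?_
    simp_rw [← Finset.sum_div, div_div, mul_div_assoc', ← Finset.sum_div, Finset.mul_sum]
    rw [Finset.sum_comm]

/-- Theorem 8.2: the potential function of the GND game induced by the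
Shapley cost sharing mechanism is `(⌈max_j α_j⌉, H_N)`-bounded:
`(1/⌈max_j α_j⌉)·C(p) ≤ Φ(p) ≤ H_N·C(p)`. -/
theorem shapley_potential_bounded
    {q : ℕ} (hq : 1 ≤ q) (α : Fin q → ℝ) (hα : ∀ j, 1 < α j)
    (αmax : ℝ) (hmax₁ : ∀ j, α j ≤ αmax) (hmax₂ : ∃ j, αmax = α j)
    {N : ℕ} (hN : 1 ≤ N)
    {E : Type*} [Fintype E] [DecidableEq E]
    (σ : E → ℝ) (hσ : ∀ e, 0 ≤ σ e)
    (ξ : E → Fin q → ℝ) (hξ : ∀ e j, 0 ≤ ξ e j)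
    (w : Fin N → E → ℝ) (hw : ∀ i e, 1 ≤ w i e)
    (p : Fin N → Finset E) :
    (⌈αmax⌉ : ℝ)⁻¹ * socialCost α σ ξ w p ≤ shapleyPotential α σ ξ w p ∧
      shapleyPotential α σ ξ w p ≤
        (∑ k ∈ Finset.Icc 1 N, (1 : ℝ) / (k : ℝ)) * socialCost α σ ξ w p := by
  obtain ⟨j₀, hj₀⟩ := hmax₂
  have hceil : αmax ≤ (⌈αmax⌉ : ℝ) := Int.le_ceil _
  have hM : (1 : ℝ) < ⌈αmax⌉ := by linarith [hα j₀]
  have hf : ∀ e, ∀ i ∈ users p e, 0 ≤ w i e := fun e i _ => zero_le_one.trans (hw i e)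
  unfold socialCost shapleyPotential
  rw [Finset.mul_sum, Finset.mul_sum]
  constructor <;> refine Finset.sum_le_sum fun e _ => ?_
  · split_ifs with hne
    · rw [sum_fixed_add_average_powersetCard, inv_mul_le_iff₀ (by linarith), mul_add,
        Finset.mul_sum]
      refine add_le_add ?_ (Finset.sum_le_sum fun j _ => ?_)
      · have hH : (1 : ℝ) ≤ ∑ k ∈ Finset.Icc 1 (users p e).card, (1 : ℝ) / k := by
          have := Finset.single_le_sum (f := fun k : ℕ => (1 : ℝ) / k)
            (fun k _ => by positivity) (Finset.mem_Icc.2 ⟨le_rfl, hne.card_pos⟩)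
          simpa using this
        rw [← mul_assoc]
        exact le_mul_of_one_le_left (hσ e) (one_le_mul_of_one_le_of_one_le hM.le hH)
      · rw [mul_left_comm]
        refine mul_le_mul_of_nonneg_left ?_ (hξ e j)
        refine (rpow_le_mul_sum_average_powersetCard_rpow _ _ (hf e) (hα j).le hne).trans ?_
        refine mul_le_mul_of_nonneg_right ((hmax₁ j).trans hceil) ?_
        refine Finset.sum_nonneg fun k _ => ?_
        refine div_nonneg (div_nonneg (Finset.sum_nonneg fun t ht => ?_) ?_) ?_
        · exact Real.rpow_nonneg (Finset.sum_nonneg fun i _ => zero_le_one.trans (hw i e)) _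
        · exact Nat.cast_nonneg _
        · exact Nat.cast_nonneg _
    · simp
  · split_ifs with hne
    · have hcard : (users p e).card ≤ N := by
        simpa using Finset.card_le_univ (users p e)
      have hH : ∑ k ∈ Finset.Icc 1 (users p e).card, (1 : ℝ) / k ≤
          ∑ k ∈ Finset.Icc 1 N, (1 : ℝ) / k :=
        Finset.sum_le_sum_of_subset_of_nonneg (Finset.Icc_subset_Icc_right hcard)
          fun k _ _ => by positivity
      rw [sum_fixed_add_average_powersetCard, mul_add, Finset.mul_sum]
      refine add_le_add (mul_le_mul_of_nonneg_right hH (hσ e)) (Finset.sum_le_sum fun j _ => ?_)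
      rw [mul_left_comm]
      refine mul_le_mul_of_nonneg_left ?_ (hξ e j)
      refine (sum_average_powersetCard_rpow_le _ _ (hf e) (by linarith [hα j])).trans ?_
      exact mul_le_mul_of_nonneg_right hH
        (Real.rpow_nonneg (Finset.sum_nonneg (hf e)) _)
    · simp
end

section
/- Let N ≥ 1 be an integer, P_1,…,P_N nonempty sets, and C_i : P_1 × ⋯ × P_N → [0,∞) individual cost functions with social cost C(p) = Σ_{i=1}^N C_i(p). Let 0 < ε < 1, ε₁ = (1+ε)/(1−ε), ϱ ≥ 1, and let C̃_i satisfy (1−ε)·C_i(p) ≤ C̃_i(p) ≤ (1+ε)·C_i(p) for all profiles p and all i. Assume there are reals λ > 0 and 0 < μ < 1/(ϱε₁²) such that Σ_i C_i(p̂_i, p_{−i}) ≤ λ·C(p̂) + μ·C(p) for all profiles p, p̂. If p is a profile such that C̃_i(p) ≤ ϱ·ε₁·C̃_i(q_i, p_{−i}) for every player i and every q_i ∈ P_i, then C(p) ≤ (ϱε₁²λ/(1 − ϱε₁²μ))·C(p*) for every profile p*. -/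
/-- Lemma 5.2: in a (λ,μ)-smooth game with μ < 1/(ϱε₁²), if a profile p
satisfies `C̃_i(p) ≤ ϱ·ε₁·C̃_i(q_i, p_{−i})` for every player i and every q_i ∈ P_i
(where the C̃_i are ε-individual costs), then
`C(p) ≤ (ϱε₁²λ/(1 − ϱε₁²μ))·C(p*)` for every profile p*. -/
theorem abrd_convergence_approx
    {N : ℕ} (hN : 1 ≤ N)
    (P : Fin N → Type*) [∀ i, Nonempty (P i)]
    (Ci : Fin N → (∀ i, P i) → ℝ) (hCnn : ∀ i p, 0 ≤ Ci i p)
    (eps : ℝ) (heps0 : 0 < eps) (heps1 : eps < 1)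
    (eps1 : ℝ) (heps1def : eps1 = (1 + eps) / (1 - eps))
    (rho : ℝ) (hrho : 1 ≤ rho)
    (Ct : Fin N → (∀ i, P i) → ℝ)
    (hCt : ∀ i p, (1 - eps) * Ci i p ≤ Ct i p ∧ Ct i p ≤ (1 + eps) * Ci i p)
    (lam mu : ℝ) (hlam : 0 < lam) (hmu0 : 0 < mu) (hmu1 : mu < 1 / (rho * eps1 ^ 2))
    (hsmooth : ∀ p phat : ∀ i, P i,
      ∑ i, Ci i (Function.update p i (phat i)) ≤
        lam * (∑ i, Ci i phat) + mu * (∑ i, Ci i p))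
    (p : ∀ i, P i)
    (hconv : ∀ (i : Fin N) (qi : P i),
      Ct i p ≤ rho * eps1 * Ct i (Function.update p i qi)) :
    ∀ pstar : ∀ i, P i,
      ∑ i, Ci i p ≤
        (rho * eps1 ^ 2 * lam / (1 - rho * eps1 ^ 2 * mu)) * ∑ i, Ci i pstar := by
  intro pstar
  have hsub : 0 < 1 - eps := by linarith
  have heps1pos : 0 < eps1 := by rw [heps1def]; positivity
  have hmul : eps1 * (1 - eps) = 1 + eps := by rw [heps1def]; field_simp
  have hK : 0 < rho * eps1 ^ 2 := by positivity
  have hden : 0 < 1 - rho * eps1 ^ 2 * mu := by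
    rw [lt_div_iff₀ hK] at hmu1
    linarith
  have hdev (i : Fin N) :
      Ci i p ≤ rho * eps1 ^ 2 * Ci i (Function.update p i (pstar i)) := by
    refine le_of_mul_le_mul_left ?_ hsub
    calc (1 - eps) * Ci i p ≤ Ct i p := (hCt i p).1
      _ ≤ rho * eps1 * Ct i (Function.update p i (pstar i)) := hconv i (pstar i)
      _ ≤ rho * eps1 * ((1 + eps) * Ci i (Function.update p i (pstar i))) := by
        gcongr
        exact (hCt i _).2
      _ = (1 - eps) * (rho * eps1 ^ 2 * Ci i (Function.update p i (pstar i))) := by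
        rw [← hmul]; ring
  have hsum : ∑ i, Ci i p ≤
      rho * eps1 ^ 2 * (lam * (∑ i, Ci i pstar) + mu * (∑ i, Ci i p)) :=
    calc ∑ i, Ci i p
        ≤ ∑ i, rho * eps1 ^ 2 * Ci i (Function.update p i (pstar i)) :=
          Finset.sum_le_sum fun i _ => hdev i
      _ = rho * eps1 ^ 2 * ∑ i, Ci i (Function.update p i (pstar i)) :=
          (Finset.mul_sum _ _ _).symm
      _ ≤ _ := mul_le_mul_of_nonneg_left (hsmooth p pstar) hK.le
  rw [div_mul_eq_mul_div, le_div_iff₀ hden]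
  linarith
end

section
/- Fix an integer q ≥ 1, reals α_1,…,α_q > 1 with α_max = max_j α_j, and an integer N ≥ 1. Let E be a finite set; for each e ∈ E let σ_e ≥ 0 and ξ_{e,j} ≥ 0 (j = 1,…,q), and define F_e(l) = 0 for l = 0 and F_e(l) = σ_e + Σ_j ξ_{e,j}·l^{α_j} for l > 0. For each player i ∈ {1,…,N} let w_i : E → ℝ with w_i(e) ≥ 1, and for a profile p = (p_1,…,p_N) of finite subsets of E let l_e^p = Σ_{i : e ∈ p_i} w_i(e) and C(p) = Σ_{e ∈ E} F_e(l_e^p). Let ϱ ≥ 1 and let p^0 and p* be two profiles such that for every player i: Σ_{e ∈ p^0_i} F_e(w_i(e)) ≤ ϱ·Σ_{e ∈ p*_i} F_e(w_i(e)). Then C(p^0) ≤ ϱ·N^{α_max}·C(p*). -/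
/-- An REP (real exponent polynomial) cost function: `F(0) = 0` and
`F(l) = σ + Σ_j ξ_j·l^{α_j}` for `l ≠ 0` (real powers). -/
noncomputable def REPcost {q : ℕ} (α : Fin q → ℝ) (σc : ℝ) (ξ : Fin q → ℝ)
    (l : ℝ) : ℝ :=
  if l = 0 then 0 else σc + ∑ j, ξ j * l ^ α j

section REPcost

variable {q : ℕ} {α : Fin q → ℝ} {σc : ℝ} {ξ : Fin q → ℝ}

lemma REPcost_zero : REPcost α σc ξ 0 = 0 := if_pos rfl

lemma REPcost_eq_add (hα : ∀ j, 1 < α j) (l : ℝ) :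
    REPcost α σc ξ l = (if l = 0 then 0 else σc) + ∑ j, ξ j * l ^ α j := by
  unfold REPcost
  split_ifs with h
  · have (j : Fin q) : ξ j * l ^ α j = 0 := by
      rw [h, Real.zero_rpow (by linarith [hα j]), mul_zero]
    simp [this]
  · rfl

lemma REPcost_nonneg (hσ : 0 ≤ σc) (hξ : ∀ j, 0 ≤ ξ j) {l : ℝ} (hl : 0 ≤ l) :
    0 ≤ REPcost α σc ξ l := by
  unfold REPcost
  split_ifs
  · exact le_rfl
  · exact add_nonneg hσ (Finset.sum_nonneg fun j _ => mul_nonneg (hξ j) (Real.rpow_nonneg hl _))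

lemma REPcost_mono (hα : ∀ j, 1 < α j) (hσ : 0 ≤ σc) (hξ : ∀ j, 0 ≤ ξ j) {a b : ℝ}
    (ha : 0 ≤ a) (hab : a ≤ b) : REPcost α σc ξ a ≤ REPcost α σc ξ b := by
  rcases ha.eq_or_lt with rfl | ha'
  · rw [REPcost_zero]
    exact REPcost_nonneg hσ hξ hab
  · have hb : b ≠ 0 := (ha'.trans_le hab).ne'
    unfold REPcost
    rw [if_neg ha'.ne', if_neg hb]
    gcongr with j
    · exact hξ j
    · linarith [hα j]

/-- Power-mean bound for the cost of an aggregate load. -/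
lemma REPcost_sum_le (hα : ∀ j, 1 < α j) (hσ : 0 ≤ σc) (hξ : ∀ j, 0 ≤ ξ j)
    {β : ℝ} (hβ : ∀ j, α j ≤ β) (hβ₁ : 1 ≤ β) {ι : Type*} {s : Finset ι} (hs : s.Nonempty)
    {x : ι → ℝ} (hx : ∀ i ∈ s, 0 ≤ x i) :
    REPcost α σc ξ (∑ i ∈ s, x i) ≤
      (s.card : ℝ) ^ (β - 1) * ∑ i ∈ s, REPcost α σc ξ (x i) := by
  have hcard : (1 : ℝ) ≤ s.card := by exact_mod_cast hs.card_pos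
  have hpow : (1 : ℝ) ≤ (s.card : ℝ) ^ (β - 1) := Real.one_le_rpow hcard (by linarith)
  have hind (i : ι) : (0 : ℝ) ≤ if x i = 0 then 0 else σc := by
    split_ifs
    exacts [le_rfl, hσ]
  have hsum : 0 ≤ ∑ i ∈ s, if x i = 0 then 0 else σc := Finset.sum_nonneg fun i _ => hind i
  simp only [REPcost_eq_add hα, Finset.sum_add_distrib, mul_add]
  gcongr ?_ + ?_
  · refine le_trans ?_ (le_mul_of_one_le_left hsum hpow)
    split_ifs with h
    · exact hsum
    · obtain ⟨i, hi, hne⟩ := Finset.exists_ne_zero_of_sum_ne_zero h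
      simpa [hne] using Finset.single_le_sum (fun i _ => hind i) hi
  · rw [Finset.sum_comm, Finset.mul_sum]
    refine Finset.sum_le_sum fun j _ => ?_
    rw [← Finset.mul_sum, mul_left_comm]
    refine mul_le_mul_of_nonneg_left ?_ (hξ j)
    refine (Real.rpow_sum_le_const_mul_sum_rpow_of_nonneg s (hα j).le hx).trans ?_
    refine mul_le_mul_of_nonneg_right ?_
      (Finset.sum_nonneg fun i hi => Real.rpow_nonneg (hx i hi) _)
    exact Real.rpow_le_rpow_of_exponent_le hcard (by linarith [hβ j])

lemma sum_REPcost_le (hα : ∀ j, 1 < α j) (hσ : 0 ≤ σc) (hξ : ∀ j, 0 ≤ ξ j)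
    {ι : Type*} {s : Finset ι} {x : ι → ℝ} (hx : ∀ i ∈ s, 0 ≤ x i) :
    ∑ i ∈ s, REPcost α σc ξ (x i) ≤ s.card * REPcost α σc ξ (∑ i ∈ s, x i) := by
  rw [← nsmul_eq_mul]
  exact Finset.sum_le_card_nsmul _ _ _ fun i hi =>
    REPcost_mono hα hσ hξ (hx i hi) (Finset.single_le_sum hx hi)

end REPcost

/-- Lemma 5.3: if the initial profile p⁰ satisfies, for each player i,
`Σ_{e ∈ p⁰_i} F_e(w_i(e)) ≤ ϱ·Σ_{e ∈ p*_i} F_e(w_i(e))`, then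
`C(p⁰) ≤ ϱ·N^{α_max}·C(p*)`. -/
theorem initial_profile_cost_bound
    {q : ℕ} (hq : 1 ≤ q) (α : Fin q → ℝ) (hα : ∀ j, 1 < α j)
    (αmax : ℝ) (hmax₁ : ∀ j, α j ≤ αmax) (hmax₂ : ∃ j, αmax = α j)
    {N : ℕ} (hN : 1 ≤ N)
    {E : Type*} [Fintype E] [DecidableEq E]
    (σ : E → ℝ) (hσ : ∀ e, 0 ≤ σ e)
    (ξ : E → Fin q → ℝ) (hξ : ∀ e j, 0 ≤ ξ e j)
    (w : Fin N → E → ℝ) (hw : ∀ i e, 1 ≤ w i e)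
    (rho : ℝ) (hrho : 1 ≤ rho)
    (p0 pstar : Fin N → Finset E)
    (hinit : ∀ i, ∑ e ∈ p0 i, REPcost α (σ e) (ξ e) (w i e) ≤
      rho * ∑ e ∈ pstar i, REPcost α (σ e) (ξ e) (w i e)) :
    (∑ e : E, REPcost α (σ e) (ξ e) (∑ i, if e ∈ p0 i then w i e else 0)) ≤
      rho * (N : ℝ) ^ αmax *
        ∑ e : E, REPcost α (σ e) (ξ e) (∑ i, if e ∈ pstar i then w i e else 0) := by
  obtain ⟨j₀, hj₀⟩ := hmax₂
  have hmax : 1 ≤ αmax := hj₀ ▸ (hα j₀).le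
  have hN' : (0 : ℝ) < N := by exact_mod_cast hN
  have hne : (Finset.univ : Finset (Fin N)).Nonempty := ⟨⟨0, hN⟩, Finset.mem_univ _⟩
  have hx (p : Fin N → Finset E) (e : E) :
      ∀ i ∈ Finset.univ, 0 ≤ if e ∈ p i then w i e else 0 := fun i _ => by
    split_ifs
    exacts [zero_le_one.trans (hw i e), le_rfl]
  have hswap (p : Fin N → Finset E) :
      ∑ e, ∑ i, REPcost α (σ e) (ξ e) (if e ∈ p i then w i e else 0) =
        ∑ i, ∑ e ∈ p i, REPcost α (σ e) (ξ e) (w i e) := by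
    rw [Finset.sum_comm]
    refine Finset.sum_congr rfl fun i _ => ?_
    simp only [apply_ite (REPcost α _ _), REPcost_zero, Finset.sum_ite_mem, Finset.univ_inter]
  calc ∑ e, REPcost α (σ e) (ξ e) (∑ i, if e ∈ p0 i then w i e else 0)
      ≤ ∑ e, (N : ℝ) ^ (αmax - 1) *
          ∑ i, REPcost α (σ e) (ξ e) (if e ∈ p0 i then w i e else 0) :=
        Finset.sum_le_sum fun e _ => by
          simpa only [Finset.card_univ, Fintype.card_fin] using
            REPcost_sum_le hα (hσ e) (hξ e) hmax₁ hmax hne (hx p0 e)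
    _ = (N : ℝ) ^ (αmax - 1) * ∑ i, ∑ e ∈ p0 i, REPcost α (σ e) (ξ e) (w i e) := by
        rw [← Finset.mul_sum, hswap]
    _ ≤ (N : ℝ) ^ (αmax - 1) *
          ∑ i, rho * ∑ e ∈ pstar i, REPcost α (σ e) (ξ e) (w i e) := by
        gcongr with i
        exact hinit i
    _ = (N : ℝ) ^ (αmax - 1) * (rho *
          ∑ e, ∑ i, REPcost α (σ e) (ξ e) (if e ∈ pstar i then w i e else 0)) := by
        rw [← Finset.mul_sum, hswap]
    _ ≤ (N : ℝ) ^ (αmax - 1) * (rho *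
          ∑ e, N * REPcost α (σ e) (ξ e) (∑ i, if e ∈ pstar i then w i e else 0)) := by
        gcongr with e
        simpa only [Finset.card_univ, Fintype.card_fin] using
          sum_REPcost_le hα (hσ e) (hξ e) (hx pstar e)
    _ = rho * (N : ℝ) ^ αmax *
          ∑ e, REPcost α (σ e) (ξ e) (∑ i, if e ∈ pstar i then w i e else 0) := by
        rw [← Finset.mul_sum, Real.rpow_sub_one hN'.ne']
        field_simp
end

section
/- Let α > 1 be a real, ξ > 0 a real, N ≥ 1 an integer, and σ = ξ·N^α. Let E consist of 2N + 1 distinct resources {e*} ∪ {a_1,…,a_N} ∪ {b_1,…,b_N}, with cost functions vanishing at load 0 and, for l > 0: F_{e*}(l) = (N/(N+1))·(σ + ξ·l^α); F_{a_i}(l) = σ + ξ·l^α; F_{b_i}(l) = (1/(N+1))·σ + (3/(N+1))·ξ·l^α. Each player i ∈ {1,…,N} has strategy set P_i = { {a_i}, {e*, b_i} } and weight 1 on every resource; for a profile p ∈ P_1 × ⋯ × P_N let l_e^p = #{i : e ∈ p_i} and C(p) = Σ_{e ∈ E} F_e(l_e^p). Suppose cost-share functions f_{i,e} : P_1 ×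 ⋯ × P_N → [0,∞) satisfy f_{i,e}(p) = 0 whenever e ∉ p_i and Σ_{i=1}^N f_{i,e}(p) = F_e(l_e^p) for every e and p, and set C_i(p) = Σ_e f_{i,e}(p). Then the profile p^A with p^A_i = {a_i} for all i is a pure Nash equilibrium, i.e., C_i(p^A) ≤ C_i(q_i, p^A_{−i}) for every i and every q_i ∈ P_i, and C(p^A) ≥ (N/3)·C(p^B), where p^B is the profile with p^B_i = {e*, b_i} for all i. -/
/-- Resource set of the lower-bound instance: the edge `e*` (left summand), the edges
`a_1,…,a_N` (middle summand) and the edges `b_1,…,b_N` (right summand). -/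
abbrev LBRes (N : ℕ) := Unit ⊕ Fin N ⊕ Fin N

/-- The cost functions of the lower-bound instance, with `σ = ξ·N^α`:
`F_{e*}(l) = (N/(N+1))·(σ + ξ·l^α)`, `F_{a_i}(l) = σ + ξ·l^α`,
`F_{b_i}(l) = σ/(N+1) + (3/(N+1))·ξ·l^α` for `l ≠ 0`, all vanishing at `l = 0`
(real powers). -/
noncomputable def lbCost (N : ℕ) (α ξ : ℝ) : LBRes N → ℝ → ℝ := fun e l =>
  if l = 0 then 0
  else
    match e with
    | Sum.inl _ => ((N : ℝ) / ((N : ℝ) + 1)) * (ξ * (N : ℝ) ^ α + ξ * l ^ α)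
    | Sum.inr (Sum.inl _) => ξ * (N : ℝ) ^ α + ξ * l ^ α
    | Sum.inr (Sum.inr _) =>
        (1 / ((N : ℝ) + 1)) * (ξ * (N : ℝ) ^ α) + (3 / ((N : ℝ) + 1)) * ξ * l ^ α

/-- The load on resource `e`: the number of players (each of weight 1) using `e`. -/
def lbLoad {N : ℕ} (p : Fin N → Finset (LBRes N)) (e : LBRes N) : ℝ :=
  ((Finset.univ.filter fun i => e ∈ p i).card : ℝ)

/-- The profile in which every player `i` chooses `{a_i}`. -/
def profA (N : ℕ) : Fin N → Finset (LBRes N) := fun i => {Sum.inr (Sum.inl i)}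

/-- The profile in which every player `i` chooses `{e*, b_i}`. -/
def profB (N : ℕ) : Fin N → Finset (LBRes N) :=
  fun i => {Sum.inl (), Sum.inr (Sum.inr i)}

theorem lbLoad_eq_one_of_unique_user {N : ℕ} {p : Fin N → Finset (LBRes N)} {e : LBRes N}
    {i : Fin N} (h : ∀ j, e ∈ p j ↔ j = i) : lbLoad p e = 1 := by
  simp [lbLoad, h, Finset.filter_eq']

/-- Under separability and budget balance, the only user of a resource pays its full cost. -/
theorem share_eq_lbCost_of_unique_user {N : ℕ} {α ξ : ℝ}
    {f : Fin N → LBRes N → (Fin N → Finset (LBRes N)) → ℝ}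
    (hf1 : ∀ i e (p : Fin N → Finset (LBRes N)), e ∉ p i → f i e p = 0)
    (hbb : ∀ e (p : Fin N → Finset (LBRes N)), ∑ i, f i e p = lbCost N α ξ e (lbLoad p e))
    {p : Fin N → Finset (LBRes N)} {e : LBRes N} {i : Fin N} (h : ∀ j, e ∈ p j ↔ j = i) :
    f i e p = lbCost N α ξ e 1 := by
  rw [← lbLoad_eq_one_of_unique_user h, ← hbb e p]
  exact (Finset.sum_eq_single i (fun j _ hj => hf1 j e p (by rwa [h j])) (by simp)).symm

/-- Under separability, the total share of a player is the sum over the resources it uses. -/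
theorem sum_share_eq_sum_strategy {N : ℕ} {f : Fin N → LBRes N → (Fin N → Finset (LBRes N)) → ℝ}
    (hf1 : ∀ i e (p : Fin N → Finset (LBRes N)), e ∉ p i → f i e p = 0)
    (p : Fin N → Finset (LBRes N)) (i : Fin N) :
    ∑ e, f i e p = ∑ e ∈ p i, f i e p :=
  (Finset.sum_subset (Finset.subset_univ _) fun e _ he => hf1 i e p he).symm

theorem sum_lbCost_profA (N : ℕ) (α ξ : ℝ) :
    ∑ e, lbCost N α ξ e (lbLoad (profA N) e) = N * (ξ * (N : ℝ) ^ α + ξ) := by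
  have ha (i : Fin N) : lbLoad (profA N) (Sum.inr (Sum.inl i)) = 1 :=
    lbLoad_eq_one_of_unique_user (i := i) fun j => by simp [profA, eq_comm]
  have hstar : lbLoad (profA N) (Sum.inl ()) = 0 := by simp [lbLoad, profA]
  have hb (i : Fin N) : lbLoad (profA N) (Sum.inr (Sum.inr i)) = 0 := by simp [lbLoad, profA]
  simp [lbCost, ha, hstar, hb]
  ring

theorem sum_lbCost_profB {N : ℕ} (hN : 1 ≤ N) (α ξ : ℝ) :
    ∑ e, lbCost N α ξ e (lbLoad (profB N) e) =
      3 * (N / ((N : ℝ) + 1)) * (ξ * (N : ℝ) ^ α + ξ) := by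
  have hN0 : N ≠ 0 := by omega
  have ha (i : Fin N) : lbLoad (profB N) (Sum.inr (Sum.inl i)) = 0 := by simp [lbLoad, profB]
  have hstar : lbLoad (profB N) (Sum.inl ()) = N := by simp [lbLoad, profB]
  have hb (i : Fin N) : lbLoad (profB N) (Sum.inr (Sum.inr i)) = 1 :=
    lbLoad_eq_one_of_unique_user (i := i) fun j => by simp [profB, eq_comm]
  simp only [lbCost, Fintype.sum_sum_type, Finset.univ_unique, PUnit.default_eq_unit, ha, hstar,
    hb, Nat.cast_eq_zero, hN0, one_ne_zero, if_true, if_false, Real.one_rpow, Finset.sum_const,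
    Finset.card_singleton, Finset.card_univ, Fintype.card_fin, nsmul_eq_mul, Nat.cast_one]
  field_simp
  ring

/-- construction of Theorem 10.2: for any separable budget-balanced
cost sharing mechanism `f` on the lower-bound instance, the profile `p^A` (every
player uses its own edge `a_i`) is a pure Nash equilibrium, and its social cost is at
least `N/3` times the social cost of the profile `p^B`. -/
theorem poa_lower_bound_budget_balanced
    {N : ℕ} (hN : 1 ≤ N) (α : ℝ) (hα : 1 < α) (ξ : ℝ) (hξ : 0 < ξ)
    (f : Fin N → LBRes N → (Fin N → Finset (LBRes N)) → ℝ)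
    (hf0 : ∀ i e p, 0 ≤ f i e p)
    (hf1 : ∀ i e (p : Fin N → Finset (LBRes N)), e ∉ p i → f i e p = 0)
    (hbb : ∀ e (p : Fin N → Finset (LBRes N)),
      ∑ i, f i e p = lbCost N α ξ e (lbLoad p e)) :
    (∀ (i : Fin N) (qi : Finset (LBRes N)),
        qi = {Sum.inr (Sum.inl i)} ∨ qi = {Sum.inl (), Sum.inr (Sum.inr i)} →
        ∑ e, f i e (profA N) ≤ ∑ e, f i e (Function.update (profA N) i qi)) ∧
      ((N : ℝ) / 3) * (∑ e, lbCost N α ξ e (lbLoad (profB N) e)) ≤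
        ∑ e, lbCost N α ξ e (lbLoad (profA N) e) := by
  constructor
  · rintro i qi (rfl | rfl)
    · exact (congrArg (fun p => ∑ e, f i e p) (Function.update_eq_self i (profA N))).ge
    · set p := Function.update (profA N) i {Sum.inl (), Sum.inr (Sum.inr i)} with hp
      have hpi : p i = {Sum.inl (), Sum.inr (Sum.inr i)} := by simp [hp]
      have hpj : ∀ j, j ≠ i → p j = {Sum.inr (Sum.inl j)} := fun j hj => by
        simp [hp, hj, profA]
      have hA : f i (Sum.inr (Sum.inl i)) (profA N) = lbCost N α ξ (Sum.inr (Sum.inl i)) 1 :=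
        share_eq_lbCost_of_unique_user hf1 hbb fun j => by simp [profA, eq_comm]
      have hstar : f i (Sum.inl ()) p = lbCost N α ξ (Sum.inl ()) 1 :=
        share_eq_lbCost_of_unique_user hf1 hbb fun j => by
          rcases eq_or_ne j i with rfl | hj
          · simp [hpi]
          · simp [hpj j hj, hj]
      have hB : f i (Sum.inr (Sum.inr i)) p = lbCost N α ξ (Sum.inr (Sum.inr i)) 1 :=
        share_eq_lbCost_of_unique_user hf1 hbb fun j => by
          rcases eq_or_ne j i with rfl | hj
          · simp [hpi]
          · simp [hpj j hj, hj]
      rw [sum_share_eq_sum_strategy hf1 (profA N), sum_share_eq_sum_strategy hf1 p, hpi,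
        Finset.sum_pair (by simp), hstar, hB]
      simp only [profA, Finset.sum_singleton]
      have hdev : lbCost N α ξ (Sum.inl ()) 1 + lbCost N α ξ (Sum.inr (Sum.inr i)) 1 =
          lbCost N α ξ (Sum.inr (Sum.inl i)) 1 + 2 * ξ / ((N : ℝ) + 1) := by
        simp only [lbCost, one_ne_zero, if_false, Real.one_rpow]
        field_simp
        ring
      rw [hA, hdev]
      exact le_add_of_nonneg_right (by positivity)
  · rw [sum_lbCost_profA, sum_lbCost_profB hN]
    have hfrac : (N : ℝ) / (N + 1) ≤ 1 := by
      rw [div_le_one (by positivity)]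
      linarith
    calc (N : ℝ) / 3 * (3 * (N / (N + 1)) * (ξ * (N : ℝ) ^ α + ξ))
        = N / (N + 1) * (N * (ξ * (N : ℝ) ^ α + ξ)) := by ring
      _ ≤ N * (ξ * (N : ℝ) ^ α + ξ) := mul_le_of_le_one_left (by positivity) hfrac
end

section
/- Let S be a nonempty finite set of players with weights w_i ≥ 1 (reals), let σ ≥ 0, q ≥ 1 an integer, α_1,…,α_q > 1 reals and ξ_1,…,ξ_q ≥ 0 reals. Define F(l) = σ + Σ_{j=1}^q ξ_j·l^{α_j} for l > 0 and F(0) = 0, and let L = Σ_{i' ∈ S} w_{i'}. Then for every i ∈ S, the Shapley cost share of i in S with respect to F satisfies f_i(S) ≤ σ + Σ_{j=1}^q ξ_j·( L^{α_j} − (L − w_i)^{α_j} ). -/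
/-- The Shapley cost share of player `i` in the finite set `X` of players with weights
`w`, with respect to the cost function `F` on loads:
`f_i(X) = (1/|X|!)·Σ_π [F(W_π(i) + w_i) − F(W_π(i))]`, where `π` ranges over all
`|X|!` linear orderings of `X` (encoded as equivalences `Fin |X| ≃ X`) and `W_π(i)`
is the total weight of the players preceding `i` in `π`.  By convention the share is
`0` when `i ∉ X`. -/
noncomputable def shapleyShare {ι : Type*} [DecidableEq ι] (w : ι → ℝ) (F : ℝ → ℝ)
    (X : Finset ι) (i : ι) : ℝ :=
  if hi : i ∈ X then
    (Nat.factorial X.card : ℝ)⁻¹ *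
      ∑ π : Fin X.card ≃ {x : ι // x ∈ X},
        (F ((∑ i' : {x : ι // x ∈ X},
              if π.symm i' < π.symm ⟨i, hi⟩ then w i'.1 else 0) + w i) -
          F (∑ i' : {x : ι // x ∈ X},
              if π.symm i' < π.symm ⟨i, hi⟩ then w i'.1 else 0))
  else 0

/-- The increments over a fixed step `x` of a convex function on `[0, ∞)` are monotone. -/
theorem ConvexOn.add_sub_le_add_sub_of_le {f : ℝ → ℝ} (hf : ConvexOn ℝ (Set.Ici 0) f)
    {a b x : ℝ} (ha : 0 ≤ a) (hab : a ≤ b) (hx : 0 < x) :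
    f (a + x) - f a ≤ f (b + x) - f b := by
  have hd : 0 < b + x - a := by linarith
  have ha' : a ∈ Set.Ici (0 : ℝ) := ha
  have hb' : b + x ∈ Set.Ici (0 : ℝ) := by simp only [Set.mem_Ici]; linarith
  have hs : 0 ≤ (b - a) / (b + x - a) := div_nonneg (by linarith) hd.le
  have ht : 0 ≤ x / (b + x - a) := div_nonneg hx.le hd.le
  have hst : (b - a) / (b + x - a) + x / (b + x - a) = 1 := by field_simp; ring
  have h₁ := hf.2 ha' hb' hs ht hst
  have h₂ := hf.2 ha' hb' ht hs (by linarith)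
  simp only [smul_eq_mul] at h₁ h₂
  rw [show (b - a) / (b + x - a) * a + x / (b + x - a) * (b + x) = a + x by
    field_simp; ring] at h₁
  rw [show x / (b + x - a) * a + (b - a) / (b + x - a) * (b + x) = b by
    field_simp; ring] at h₂
  linear_combination h₁ + h₂ + (f a + f (b + x)) * hst

/-- An upper bound on the marginal cost of `i` over every load between `0` and the total weight
of the other players bounds the Shapley share of `i`. -/
theorem shapleyShare_le_of_marginal_le {ι : Type*} [DecidableEq ι] {w : ι → ℝ} {F : ℝ → ℝ}
    {X : Finset ι} {i : ι} (hi : i ∈ X) (hw : ∀ j ∈ X, 0 ≤ w j) {B : ℝ}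
    (hB : ∀ a, 0 ≤ a → a ≤ (∑ j ∈ X, w j) - w i → F (a + w i) - F a ≤ B) :
    shapleyShare w F X i ≤ B := by
  rw [shapleyShare, dif_pos hi, inv_mul_le_iff₀ (by positivity)]
  refine (Finset.sum_le_card_nsmul _ _ B fun π _ => hB _ ?_ ?_).trans_eq ?_
  · refine Finset.sum_nonneg fun j _ => ?_
    split_ifs
    exacts [hw j j.2, le_rfl]
  · rw [← Finset.sum_coe_sort X w, le_sub_iff_add_le,
      ← Finset.sum_erase_add _ _ (Finset.mem_univ (⟨i, hi⟩ : {x // x ∈ X})),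
      ← Finset.sum_erase_add _ _ (Finset.mem_univ (⟨i, hi⟩ : {x // x ∈ X}))]
    simp only [lt_irrefl, if_false, add_zero]
    gcongr with j
    split_ifs
    exacts [le_rfl, hw j j.2]
  · rw [Finset.card_univ, Fintype.card_equiv X.equivFin.symm, Fintype.card_fin, nsmul_eq_mul]

/-- with `F(0) = 0`, `F(l) = σ + Σ_j ξ_j·l^{α_j}` for `l ≠ 0` and
`L = Σ_{i' ∈ S} w_{i'}`, the Shapley cost share of every `i ∈ S` satisfies
`f_i(S) ≤ σ + Σ_j ξ_j·(L^{α_j} − (L − w_i)^{α_j})` (real powers). -/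
theorem shapley_share_upper_bound
    {ι : Type*} [DecidableEq ι] (S : Finset ι) (hS : S.Nonempty)
    (w : ι → ℝ) (hw : ∀ i ∈ S, 1 ≤ w i)
    (σ : ℝ) (hσ : 0 ≤ σ)
    {q : ℕ} (hq : 1 ≤ q) (α : Fin q → ℝ) (hα : ∀ j, 1 < α j)
    (ξ : Fin q → ℝ) (hξ : ∀ j, 0 ≤ ξ j)
    (i : ι) (hi : i ∈ S) :
    shapleyShare w (fun l => if l = 0 then 0 else σ + ∑ j, ξ j * l ^ α j) S i ≤
      σ + ∑ j, ξ j * ((∑ i' ∈ S, w i') ^ α j - ((∑ i' ∈ S, w i') - w i) ^ α j) := by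
  refine shapleyShare_le_of_marginal_le hi (fun j hj => zero_le_one.trans (hw j hj))
    fun a ha hal => ?_
  have hwi : 0 < w i := zero_lt_one.trans_le (hw i hi)
  have key : ∑ j, ξ j * ((a + w i) ^ α j - a ^ α j) ≤
      ∑ j, ξ j * ((∑ i' ∈ S, w i') ^ α j - ((∑ i' ∈ S, w i') - w i) ^ α j) := by
    refine Finset.sum_le_sum fun j _ => mul_le_mul_of_nonneg_left ?_ (hξ j)
    simpa using (convexOn_rpow (hα j).le).add_sub_le_add_sub_of_le ha hal hwi
  simp only [mul_sub, Finset.sum_sub_distrib] at key ⊢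
  rw [if_neg (by positivity)]
  split_ifs with h0
  · have hz : ∑ j, ξ j * a ^ α j = 0 := Finset.sum_eq_zero fun j _ => by
      rw [h0, Real.zero_rpow (zero_lt_one.trans (hα j)).ne', mul_zero]
    linarith
  · linarith
end

section
/- For every real α > 1 there exists a real constant z ≥ 0 such that for all reals w and l with 1 ≤ w ≤ l: l^α − (l − w)^α ≤ 3^α·w^α + z·w·(l − w)^{α−1}. -/
/-- Bernoulli's inequality in difference form: `l ^ α - (l - w) ^ α ≤ α w l ^ (α - 1)`. -/
lemma rpow_sub_rpow_sub_le {α w l : ℝ} (hα : 1 ≤ α) (hl : 0 < l) (hwl : w ≤ l) :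
    l ^ α - (l - w) ^ α ≤ α * w * l ^ (α - 1) := by
  have hdiv : w / l ≤ 1 := (div_le_one hl).2 hwl
  have bernoulli := one_add_mul_self_le_rpow_one_add (s := -(w / l)) (by linarith) hα
  have hm : l - w = l * (1 + -(w / l)) := by field_simp; ring
  have hpow : l ^ α = l * l ^ (α - 1) := by
    rw [Real.rpow_sub_one hl.ne']; field_simp
  have hmul := mul_le_mul_of_nonneg_left bernoulli (Real.rpow_nonneg hl.le α)
  rw [← Real.mul_rpow hl.le (by linarith), ← hm] at hmul
  have hlin : l ^ α * (1 + α * -(w / l)) = l ^ α - α * w * l ^ (α - 1) := by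
    rw [hpow]; field_simp; ring
  linarith

/-- for every real α > 1 there is a constant z ≥ 0 such that for all
reals 1 ≤ w ≤ l, `l^α − (l−w)^α ≤ 3^α·w^α + z·w·(l−w)^{α−1}` (real powers). -/
theorem shapley_rep_expanded_analytic (α : ℝ) (hα : 1 < α) :
    ∃ z : ℝ, 0 ≤ z ∧ ∀ w l : ℝ, 1 ≤ w → w ≤ l →
      l ^ α - (l - w) ^ α ≤ (3 : ℝ) ^ α * w ^ α + z * w * (l - w) ^ (α - 1) := by
  refine ⟨α * (3 / 2) ^ (α - 1), by positivity, fun w l hw hwl => ?_⟩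
  have hw0 : 0 < w := by linarith
  have hm : 0 ≤ l - w := by linarith
  rcases le_total l (3 * w) with h | h
  · have hle : l ^ α ≤ (3 * w) ^ α := Real.rpow_le_rpow (by linarith) h (by linarith)
    rw [Real.mul_rpow (by norm_num) hw0.le] at hle
    have hmα : 0 ≤ (l - w) ^ α := by positivity
    have hz : 0 ≤ α * (3 / 2) ^ (α - 1) * w * (l - w) ^ (α - 1) := by positivity
    linarith
  · have hle : l ^ (α - 1) ≤ (3 / 2 * (l - w)) ^ (α - 1) :=
      Real.rpow_le_rpow (by linarith) (by linarith) (by linarith)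
    rw [Real.mul_rpow (by norm_num) hm] at hle
    have h3 : 0 ≤ (3 : ℝ) ^ α * w ^ α := by positivity
    calc l ^ α - (l - w) ^ α ≤ α * w * l ^ (α - 1) :=
          rpow_sub_rpow_sub_le hα.le (by linarith) hwl
      _ ≤ α * w * ((3 / 2) ^ (α - 1) * (l - w) ^ (α - 1)) := by gcongr
      _ ≤ _ := by linarith
end

section
/- Let q ≥ 1 be an integer, α_1,…,α_q > 1 reals, σ ≥ 0 and ξ_1,…,ξ_q ≥ 0 reals. Then for all reals w and l with 1 ≤ w ≤ l: (w/l)·( σ + Σ_{j=1}^q ξ_j·l^{α_j} ) ≤ σ + Σ_{j=1}^q ξ_j·2^{α_j − 1}·( w^{α_j} + w·(l − w)^{α_j − 1} ). -/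
/-- Quasi-triangle inequality for real powers with a nonnegative exponent. -/
theorem add_rpow_le_two_rpow_mul {a b p : ℝ} (ha : 0 ≤ a) (hb : 0 ≤ b) (hp : 0 ≤ p) :
    (a + b) ^ p ≤ (2 : ℝ) ^ p * (a ^ p + b ^ p) := by
  wlog hab : a ≤ b generalizing a b
  · rw [add_comm a b, add_comm (a ^ p)]
    exact this hb ha (le_of_not_ge hab)
  calc (a + b) ^ p ≤ (2 * b) ^ p := by
        apply Real.rpow_le_rpow <;> linarith
    _ = (2 : ℝ) ^ p * b ^ p := Real.mul_rpow zero_le_two hb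
    _ ≤ (2 : ℝ) ^ p * (a ^ p + b ^ p) := by
        gcongr
        exact le_add_of_nonneg_left (Real.rpow_nonneg ha p)

/-- A proportional share of the power cost `l ^ a` is bounded by the player's own cost and the
cost induced by the remaining load. -/
theorem proportional_share_rpow_le {a w l : ℝ} (ha : 1 ≤ a) (hw : 0 < w) (hwl : w ≤ l) :
    w / l * l ^ a ≤ (2 : ℝ) ^ (a - 1) * (w ^ a + w * (l - w) ^ (a - 1)) := by
  have hl : 0 < l := hw.trans_le hwl
  have h := add_rpow_le_two_rpow_mul hw.le (sub_nonneg.2 hwl) (sub_nonneg.2 ha)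
  rw [add_sub_cancel] at h
  have hwa : w ^ a = w * w ^ (a - 1) := by
    rw [Real.rpow_sub_one hw.ne', mul_div_cancel₀ _ hw.ne']
  calc w / l * l ^ a = w * l ^ (a - 1) := by
        rw [Real.rpow_sub_one hl.ne']; ring
    _ ≤ w * ((2 : ℝ) ^ (a - 1) * (w ^ (a - 1) + (l - w) ^ (a - 1))) := by gcongr
    _ = (2 : ℝ) ^ (a - 1) * (w ^ a + w * (l - w) ^ (a - 1)) := by rw [hwa]; ring

/-- the proportional fair cost sharing mechanism is REP-expanded:
for q ≥ 1, α_j > 1, σ ≥ 0, ξ_j ≥ 0 and all reals 1 ≤ w ≤ l,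
`(w/l)·(σ + Σ_j ξ_j·l^{α_j}) ≤ σ + Σ_j ξ_j·2^{α_j−1}·(w^{α_j} + w·(l−w)^{α_j−1})`. -/
theorem proportional_fair_rep_expanded
    {q : ℕ} (hq : 1 ≤ q) (α : Fin q → ℝ) (hα : ∀ j, 1 < α j)
    (σ : ℝ) (hσ : 0 ≤ σ) (ξ : Fin q → ℝ) (hξ : ∀ j, 0 ≤ ξ j) :
    ∀ w l : ℝ, 1 ≤ w → w ≤ l →
      (w / l) * (σ + ∑ j, ξ j * l ^ α j) ≤
        σ + ∑ j, ξ j * (2 : ℝ) ^ (α j - 1) * (w ^ α j + w * (l - w) ^ (α j - 1)) := by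
  intro w l hw hwl
  have hw0 : 0 < w := zero_lt_one.trans_le hw
  rw [mul_add, Finset.mul_sum]
  refine add_le_add ?_ (Finset.sum_le_sum fun j _ => ?_)
  · exact mul_le_of_le_one_left hσ (div_le_one_of_le₀ hwl (hw0.le.trans hwl))
  · rw [mul_left_comm, mul_assoc]
    exact mul_le_mul_of_nonneg_left (proportional_share_rpow_le (hα j).le hw0 hwl) (hξ j)
end

section
/- Let ι be a type, w : ι → ℝ with w_i ≥ 1 for all i, q ≥ 1 an integer, α_1,…,α_q > 1 reals and ξ_1,…,ξ_q ≥ 0 reals. Define h(X) = Σ_{j=1}^q ξ_j·(Σ_{i ∈ X} w_i)^{α_j} for finite sets X of indices. Then h is supermodular: for all finite sets X_1 ⊆ X_2 and every i' ∉ X_2, h(X_1 ∪ {i'}) − h(X_1) ≤ h(X_2 ∪ {i'}) − h(X_2). -/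
/-- The increments of a convex function over intervals of a fixed length are monotone. -/
theorem ConvexOn.add_sub_le_add_sub {s : Set ℝ} {f : ℝ → ℝ} (hf : ConvexOn ℝ s f) {x y d : ℝ}
    (hx : x ∈ s) (hyd : y + d ∈ s) (hxy : x ≤ y) (hd : 0 ≤ d) :
    f (x + d) - f x ≤ f (y + d) - f y := by
  rcases hd.eq_or_lt with rfl | hd
  · simp
  have hpos : 0 < y - x + d := by linarith
  have ht : 0 ≤ d / (y - x + d) := by positivity
  have ht' : 0 ≤ (y - x) / (y - x + d) := div_nonneg (by linarith) hpos.le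
  have hsum : (y - x) / (y - x + d) + d / (y - x + d) = 1 := by field_simp
  have h₁ := hf.2 hx hyd ht' ht hsum
  have h₂ := hf.2 hx hyd ht ht' (by linarith)
  have e₁ : (y - x) / (y - x + d) * x + d / (y - x + d) * (y + d) = x + d := by
    field_simp
    ring
  have e₂ : d / (y - x + d) * x + (y - x) / (y - x + d) * (y + d) = y := by
    field_simp
    ring
  simp only [smul_eq_mul, e₁] at h₁
  simp only [smul_eq_mul, e₂] at h₂
  linear_combination h₁ + h₂ + (f x + f (y + d)) * hsum

/-- the polynomial part of an REP cost function is supermodular: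
with weights w_i ≥ 1, q ≥ 1, α_j > 1, ξ_j ≥ 0 and
h(X) = Σ_j ξ_j·(Σ_{i∈X} w_i)^{α_j}, for all finite X₁ ⊆ X₂ and i' ∉ X₂ one has
h(X₁ ∪ {i'}) − h(X₁) ≤ h(X₂ ∪ {i'}) − h(X₂). -/
theorem rep_polynomial_part_supermodular
    {ι : Type*} [DecidableEq ι] (w : ι → ℝ) (hw : ∀ i, 1 ≤ w i)
    {q : ℕ} (hq : 1 ≤ q) (α : Fin q → ℝ) (hα : ∀ j, 1 < α j)
    (ξ : Fin q → ℝ) (hξ : ∀ j, 0 ≤ ξ j) :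
    ∀ X₁ X₂ : Finset ι, X₁ ⊆ X₂ → ∀ i' ∉ X₂,
      (∑ j, ξ j * (∑ i ∈ insert i' X₁, w i) ^ α j) -
          (∑ j, ξ j * (∑ i ∈ X₁, w i) ^ α j) ≤
        (∑ j, ξ j * (∑ i ∈ insert i' X₂, w i) ^ α j) -
          (∑ j, ξ j * (∑ i ∈ X₂, w i) ^ α j) := by
  intro X₁ X₂ hX i' hi'
  have hw₀ : ∀ i, 0 ≤ w i := fun i => zero_le_one.trans (hw i)
  rw [← Finset.sum_sub_distrib, ← Finset.sum_sub_distrib]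
  refine Finset.sum_le_sum fun j _ => ?_
  rw [← mul_sub, ← mul_sub, Finset.sum_insert hi', Finset.sum_insert fun h => hi' (hX h),
    add_comm (w i'), add_comm (w i')]
  exact mul_le_mul_of_nonneg_left
    ((convexOn_rpow (hα j).le).add_sub_le_add_sub (Finset.sum_nonneg fun i _ => hw₀ i)
      (add_nonneg (Finset.sum_nonneg fun i _ => hw₀ i) (hw₀ i'))
      (Finset.sum_le_sum_of_subset_of_nonneg hX fun i _ _ => hw₀ i) (hw₀ i')) (hξ j)
end

section
/- Fix an integer q ≥ 1 and reals α_1,…,α_q > 1. Let E be a finite set; for each e ∈ E let σ_e ≥ 0, ξ_{e,j} > 0 (j = 1,…,q), and a load l_e ≥ 0 be given, and let γ be a real such that γ ≥ min_{j ∈ {1,…,q}} ((1/(α_j − 1))·σ_e/ξ_{e,j})^{1/α_j} for every e ∈ E. Then Σ_{e ∈ E} σ_e·l_e ≤ γ · Σ_{e ∈ E, l_e > 0} ( σ_e + Σ_{j=1}^q ξ_{e,j}·l_e^{α_j} ). -/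
/-- If `t` is the balancing load, at which `s = (a - 1) * x * t ^ a`, then the linear function
`s * l` is at most `t` times the cost `s + x * l ^ a`. -/
theorem mul_le_balance_mul_add_rpow {a s x l : ℝ} (ha : 1 < a) (hs : 0 ≤ s) (hx : 0 < x)
    (hl : 0 ≤ l) :
    s * l ≤ (1 / (a - 1) * (s / x)) ^ (1 / a) * (s + x * l ^ a) := by
  have ha' : 0 < a - 1 := sub_pos.2 ha
  rcases hs.eq_or_lt with rfl | hs
  · rw [zero_mul]
    positivity
  have hb : 0 < 1 / (a - 1) * (s / x) := by positivity
  set t := (1 / (a - 1) * (s / x)) ^ (1 / a) with ht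
  have ht0 : 0 < t := Real.rpow_pos_of_pos hb _
  have hta : t ^ a = 1 / (a - 1) * (s / x) := by
    rw [ht, one_div a, Real.rpow_inv_rpow hb.le (by positivity)]
  have hst : x * t ^ a * (a - 1) = s := by
    rw [hta]
    field_simp
  have hbern : 1 + a * (l / t - 1) ≤ (l / t) ^ a := by
    have h := one_add_mul_self_le_rpow_one_add (s := l / t - 1)
      (by linarith [div_nonneg hl ht0.le]) ha.le
    rwa [add_sub_cancel] at h
  have hla : l ^ a = t ^ a * (l / t) ^ a := by
    rw [← Real.mul_rpow ht0.le (by positivity), mul_div_cancel₀ l ht0.ne']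
  calc s * l = x * t ^ a * (a - 1) * l := by rw [hst]
    _ ≤ x * t ^ a * a * l := by gcongr; linarith
    _ = t * (x * t ^ a * (a - 1) + x * (t ^ a * (1 + a * (l / t - 1)))) := by
      field_simp
      ring
    _ ≤ t * (x * t ^ a * (a - 1) + x * (t ^ a * (l / t) ^ a)) := by gcongr
    _ = t * (s + x * l ^ a) := by rw [hst, ← hla]

/-- the "static part" claim in the proof of Theorem 7.1: for loads
`l_e ≥ 0` and any real `γ` with `γ ≥ min_j ((1/(α_j−1))·σ_e/ξ_{e,j})^{1/α_j}` for
every resource `e`,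
`Σ_e σ_e·l_e ≤ γ·Σ_{e : l_e > 0} (σ_e + Σ_j ξ_{e,j}·l_e^{α_j})` (real powers). -/
theorem static_part_claim
    {q : ℕ} (hq : 1 ≤ q) (α : Fin q → ℝ) (hα : ∀ j, 1 < α j)
    {E : Type*} [Fintype E]
    (σ : E → ℝ) (hσ : ∀ e, 0 ≤ σ e)
    (ξ : E → Fin q → ℝ) (hξ : ∀ e j, 0 < ξ e j)
    (l : E → ℝ) (hl : ∀ e, 0 ≤ l e)
    (γ : ℝ)
    (hγ : ∀ e, ∃ j, (1 / (α j - 1) * (σ e / ξ e j)) ^ (1 / α j) ≤ γ) :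
    ∑ e, σ e * l e ≤
      γ * ∑ e, (if 0 < l e then σ e + ∑ j, ξ e j * l e ^ α j else 0) := by
  rw [Finset.mul_sum]
  refine Finset.sum_le_sum fun e _ => ?_
  split_ifs with h
  · obtain ⟨j, hj⟩ := hγ e
    have hterm : ∀ i, 0 ≤ ξ e i * l e ^ α i := fun i =>
      mul_nonneg (hξ e i).le (Real.rpow_nonneg (hl e) _)
    have hsum : ξ e j * l e ^ α j ≤ ∑ i, ξ e i * l e ^ α i :=
      Finset.single_le_sum (fun i _ => hterm i) (Finset.mem_univ j)
    have hbase : 0 ≤ 1 / (α j - 1) * (σ e / ξ e j) :=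
      mul_nonneg (one_div_nonneg.2 (sub_pos.2 (hα j)).le) (div_nonneg (hσ e) (hξ e j).le)
    have hγ0 : 0 ≤ γ := (Real.rpow_nonneg hbase _).trans hj
    calc σ e * l e
        ≤ (1 / (α j - 1) * (σ e / ξ e j)) ^ (1 / α j) * (σ e + ξ e j * l e ^ α j) :=
          mul_le_balance_mul_add_rpow (hα j) (hσ e) (hξ e j) (hl e)
      _ ≤ γ * (σ e + ξ e j * l e ^ α j) :=
          mul_le_mul_of_nonneg_right hj (add_nonneg (hσ e) (hterm j))
      _ ≤ γ * (σ e + ∑ i, ξ e i * l e ^ α i) := by gcongr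
  · simp [le_antisymm (not_lt.1 h) (hl e)]
end

section
/- Let α > 1 and ϱ ≥ 1 be reals, K ≥ 1 an integer, z ≥ 1 a real, and for k = 1,…,K let z_k ∈ [0, z], x_k ∈ [0, α − 1] and y_k ∈ [1, α] be reals with x_k + y_k = α. Then for all reals A ≥ 0 and B ≥ 0: Σ_{k=1}^K z_k · A^{x_k/α} · B^{y_k/α} ≤ K·z·(2Kzϱ)^α · B + A/(2ϱ). -/
/-- A weighted geometric mean of `A` and `B` is controlled by a large multiple of `B` plus a small
multiple of `A`, as long as the weight of `B` is at least `1 / α`. -/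
theorem rpow_mul_rpow_le_rpow_mul_add_div {α x y A B C : ℝ} (hx : 0 ≤ x) (hy : 1 ≤ y)
    (hxy : x + y = α) (hA : 0 ≤ A) (hB : 0 ≤ B) (hC : 1 ≤ C) :
    A ^ (x / α) * B ^ (y / α) ≤ C ^ α * B + A / C := by
  have hα : 0 < α := by linarith
  have hC0 : 0 < C := by linarith
  have hxα : 0 ≤ x / α := by positivity
  have hyα : 0 ≤ y / α := by positivity
  have split (t : ℝ) (ht : 0 ≤ t) : t ^ (x / α) * t ^ (y / α) = t := by
    rw [← Real.rpow_add_of_nonneg ht hxα hyα, ← add_div, hxy, div_self hα.ne', Real.rpow_one]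
  have scale (w : ℝ) : (C ^ α * B) ^ (w / α) = C ^ w * B ^ (w / α) := by
    rw [Real.mul_rpow (by positivity) hB, ← Real.rpow_mul hC0.le, mul_div_cancel₀ _ hα.ne']
  rcases le_total A (C ^ α * B) with h | h
  · calc A ^ (x / α) * B ^ (y / α) ≤ (C ^ α * B) ^ (x / α) * B ^ (y / α) := by gcongr
      _ = C ^ x * B := by rw [scale, mul_assoc, split B hB]
      _ ≤ C ^ α * B := by
        gcongr
        linarith
      _ ≤ C ^ α * B + A / C := le_add_of_nonneg_right (by positivity)
  · have hterm : A ^ (x / α) * B ^ (y / α) ≤ A / C := by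
      rw [le_div_iff₀ hC0]
      calc A ^ (x / α) * B ^ (y / α) * C = A ^ (x / α) * (C ^ (1 : ℝ) * B ^ (y / α)) := by
            rw [Real.rpow_one]; ring
        _ ≤ A ^ (x / α) * (C ^ y * B ^ (y / α)) := by
            gcongr
        _ = A ^ (x / α) * (C ^ α * B) ^ (y / α) := by rw [scale]
        _ ≤ A ^ (x / α) * A ^ (y / α) := by gcongr
        _ = A := split A hA
    exact hterm.trans (le_add_of_nonneg_left (by positivity))


/-- the case analysis of the "dynamic part" of the smoothness proof.
For α > 1, ϱ ≥ 1, K ≥ 1, z ≥ 1, coefficients z_k ∈ [0,z] and exponents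
x_k ∈ [0,α−1], y_k ∈ [1,α] with x_k + y_k = α, and all A, B ≥ 0:
`Σ_k z_k·A^{x_k/α}·B^{y_k/α} ≤ K·z·(2Kzϱ)^α·B + A/(2ϱ)` (real powers). -/
theorem dynamic_part_case_analysis
    (α rho : ℝ) (hα : 1 < α) (hrho : 1 ≤ rho)
    {K : ℕ} (hK : 1 ≤ K) (z : ℝ) (hz : 1 ≤ z)
    (zc x y : Fin K → ℝ)
    (hzc : ∀ k, zc k ∈ Set.Icc 0 z)
    (hx : ∀ k, x k ∈ Set.Icc 0 (α - 1))
    (hy : ∀ k, y k ∈ Set.Icc 1 α)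
    (hxy : ∀ k, x k + y k = α) :
    ∀ A B : ℝ, 0 ≤ A → 0 ≤ B →
      ∑ k, zc k * A ^ (x k / α) * B ^ (y k / α) ≤
        (K : ℝ) * z * (2 * (K : ℝ) * z * rho) ^ α * B + A / (2 * rho) := by
  intro A B hA hB
  have hK' : (1 : ℝ) ≤ K := by exact_mod_cast hK
  have hC : 1 ≤ 2 * (K : ℝ) * z * rho :=
    one_le_mul_of_one_le_of_one_le
      (one_le_mul_of_one_le_of_one_le (by linarith) hz) hrho
  calc ∑ k, zc k * A ^ (x k / α) * B ^ (y k / α)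
      ≤ ∑ _k : Fin K, z * ((2 * (K : ℝ) * z * rho) ^ α * B + A / (2 * (K : ℝ) * z * rho)) := by
        refine Finset.sum_le_sum fun k _ => ?_
        rw [mul_assoc]
        exact mul_le_mul (hzc k).2
          (rpow_mul_rpow_le_rpow_mul_add_div (hx k).1 (hy k).1 (hxy k) hA hB hC)
          (by positivity) (by linarith)
    _ = (K : ℝ) * z * (2 * (K : ℝ) * z * rho) ^ α * B + A / (2 * rho) := by
        have hK0 : (K : ℝ) ≠ 0 := by positivity
        have hz0 : z ≠ 0 := by positivity
        have hrho0 : rho ≠ 0 := by positivity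
        rw [Finset.sum_const, Finset.card_univ, Fintype.card_fin, nsmul_eq_mul]
        generalize (2 * (K : ℝ) * z * rho) ^ α = c
        field_simp
end

section
/- Let N ≥ 1 be an integer, P_1,…,P_N nonempty sets, and C_i : P_1 × ⋯ × P_N → [0,∞) individual cost functions. Let 0 < ε < 1, ε₁ = (1+ε)/(1−ε), and let C̃_i satisfy (1−ε)·C_i(p) ≤ C̃_i(p) ≤ (1+ε)·C_i(p) for all profiles p and all i. Let Φ : P_1 × ⋯ × P_N → ℝ be a potential function, i.e., Φ(p) − Φ(p') = C_j(p) − C_j(p') whenever p_{−j} = p'_{−j}. If p is a profile, j a player, q_j ∈ P_j, and q = (q_j, p_{−j}) satisfies C̃_j(p) > ε₁·C̃_j(q), then Φ(p) > Φ(q). -/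
/-- the potential function strictly decreases in a step of the ABRD in
which the updating player's ε-individual cost improves by more than the factor
ε₁ = (1+ε)/(1−ε): if Φ is a potential function for the individual costs C_i, the C̃_i
are ε-approximations of the C_i, and `C̃_j(p) > ε₁·C̃_j(q_j, p_{−j})`, then Φ(p) > Φ(q). -/
theorem potential_decreases_in_abrd_step
    {N : ℕ} (hN : 1 ≤ N)
    (P : Fin N → Type*) [∀ i, Nonempty (P i)]
    (Ci : Fin N → (∀ i, P i) → ℝ) (hCnn : ∀ i p, 0 ≤ Ci i p)
    (eps : ℝ) (heps0 : 0 < eps) (heps1 : eps < 1)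
    (eps1 : ℝ) (heps1def : eps1 = (1 + eps) / (1 - eps))
    (Ct : Fin N → (∀ i, P i) → ℝ)
    (hCt : ∀ i p, (1 - eps) * Ci i p ≤ Ct i p ∧ Ct i p ≤ (1 + eps) * Ci i p)
    (Phi : (∀ i, P i) → ℝ)
    (hPhi : ∀ (j : Fin N) (p p' : ∀ i, P i), (∀ i, i ≠ j → p i = p' i) →
      Phi p - Phi p' = Ci j p - Ci j p')
    (p : ∀ i, P i) (j : Fin N) (qj : P j)
    (himpr : Ct j p > eps1 * Ct j (Function.update p j qj)) :
    Phi p > Phi (Function.update p j qj) := by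
  have hsub : 0 < 1 - eps := by linarith
  have hadd : 0 < 1 + eps := by linarith
  have heps1pos : 0 ≤ eps1 := by rw [heps1def]; positivity
  have hmul : eps1 * (1 - eps) = 1 + eps := by
    rw [heps1def, div_mul_cancel₀ _ hsub.ne']
  have hdiff := hPhi j p (Function.update p j qj)
    fun i hi => (Function.update_of_ne hi qj p).symm
  have hcost : Ci j (Function.update p j qj) < Ci j p := by
    refine lt_of_mul_lt_mul_left ?_ hadd.le
    calc (1 + eps) * Ci j (Function.update p j qj)
        = eps1 * ((1 - eps) * Ci j (Function.update p j qj)) := by rw [← mul_assoc, hmul]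
      _ ≤ eps1 * Ct j (Function.update p j qj) :=
        mul_le_mul_of_nonneg_left (hCt j _).1 heps1pos
      _ < Ct j p := himpr
      _ ≤ (1 + eps) * Ci j p := (hCt j p).2
  linarith
end

section
/- For every real α > 1, every real σ ≥ 1, and every natural number x: max( x·(σ + 1)/(1 + σ^{α/(2α−1)}) , σ^{1 + α/(2α−1)}·(x + 1)^{1−α}/(2·σ^{1 + 1/(2α−1)}) ) ≥ (1/2)·σ^{(α−1)/(2α−1)}. -/
/-- for every real α > 1, every real σ ≥ 1 and every natural number x,
`max( x·(σ+1)/(1 + σ^{α/(2α−1)}) , σ^{1+α/(2α−1)}·(x+1)^{1−α}/(2·σ^{1+1/(2α−1)}) )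
  ≥ (1/2)·σ^{(α−1)/(2α−1)}` (real powers). -/
theorem weight_scaling_lower_bound (α : ℝ) (hα : 1 < α) (σ : ℝ) (hσ : 1 ≤ σ) (x : ℕ) :
    (1 / 2 : ℝ) * σ ^ ((α - 1) / (2 * α - 1)) ≤
      max ((x : ℝ) * (σ + 1) / (1 + σ ^ (α / (2 * α - 1))))
        (σ ^ (1 + α / (2 * α - 1)) * ((x : ℝ) + 1) ^ (1 - α) /
          (2 * σ ^ (1 + 1 / (2 * α - 1)))) := by
  have hα' : 0 < 2 * α - 1 := by linarith
  have hσ' : 0 < σ := by linarith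
  rcases Nat.eq_zero_or_pos x with rfl | hx
  · refine le_max_of_le_right (le_of_eq ?_)
    have hexp : 1 + α / (2 * α - 1) = (α - 1) / (2 * α - 1) + (1 + 1 / (2 * α - 1)) := by
      field_simp
      ring
    rw [hexp, Real.rpow_add hσ']
    have hpos := Real.rpow_pos_of_pos hσ' (1 + 1 / (2 * α - 1))
    simp only [Nat.cast_zero, zero_add, Real.one_rpow]
    field_simp
  · refine le_max_of_le_left ?_
    have hx' : (1 : ℝ) ≤ x := by exact_mod_cast hx
    have hmul : σ ^ ((α - 1) / (2 * α - 1)) * σ ^ (α / (2 * α - 1)) = σ := by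
      rw [← Real.rpow_add hσ', ← add_div, show α - 1 + α = 2 * α - 1 by ring,
        div_self hα'.ne', Real.rpow_one]
    have hle : σ ^ ((α - 1) / (2 * α - 1)) ≤ σ :=
      Real.rpow_le_self_of_one_le hσ ((div_le_one hα').2 (by linarith))
    have hpos := Real.rpow_pos_of_pos hσ' (α / (2 * α - 1))
    rw [le_div_iff₀ (by linarith)]
    calc (1 / 2 : ℝ) * σ ^ ((α - 1) / (2 * α - 1)) * (1 + σ ^ (α / (2 * α - 1)))
        = (σ ^ ((α - 1) / (2 * α - 1)) + σ) / 2 := by linear_combination hmul / 2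
      _ ≤ σ + 1 := by linarith
      _ ≤ x * (σ + 1) := le_mul_of_one_le_left (by linarith) hx'
end
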